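/- arXiv:1711.07114 — 7 statements merged into one kernel-verified Lean document; each statement's English description precedes it below -/
import Mathlib

section
/- Let β ∈ (0,1) and p ∈ (1,∞). Consider the weights w, σ on ℝ given by σ(x) = |x|^{−β} and w(x) = |x|^{β(p−1)} for x ≠ 0 (and w(0) = σ(0) = 1). Then [w,σ]_{A_p} is comparable to (1−β)^{1−p}, with comparability constants depending only on p. In particular, [w]_{A_∞} ≤ C(p) for a constant depending only on p. -/
open MeasureTheory Set Filter
open scoped ENNReal NNReal

noncomputable section

/-- Average of `g` over the interval `[a, b)` (with respect to Lebesgue measure). -/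
def avgI (g : ℝ → ℝ) (a b : ℝ) : ℝ := (b - a)⁻¹ * ∫ x in Set.Ico a b, g x

/-- The dyadic interval `[k·2^{-n}, (k+1)·2^{-n})`. -/
def dyadicI (n k : ℤ) : Set ℝ :=
  Set.Ico ((k : ℝ) * (2:ℝ) ^ (-n)) (((k : ℝ) + 1) * (2:ℝ) ^ (-n))

/-- Average of `g` over the dyadic interval `dyadicI n k`. -/
def avgD (g : ℝ → ℝ) (n k : ℤ) : ℝ :=
  avgI g ((k : ℝ) * (2:ℝ) ^ (-n)) (((k : ℝ) + 1) * (2:ℝ) ^ (-n))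

/-- The martingale difference `Δ_Q g` associated with the dyadic interval `Q = dyadicI n k`:
`Δ_Q g = Σ_{R child of Q} ⟨g⟩_R 1_R − ⟨g⟩_Q 1_Q`. -/
def deltaD (g : ℝ → ℝ) (n k : ℤ) (x : ℝ) : ℝ :=
  (dyadicI (n+1) (2*k)).indicator (fun _ => avgD g (n+1) (2*k)) x
    + (dyadicI (n+1) (2*k+1)).indicator (fun _ => avgD g (n+1) (2*k+1)) x
    - (dyadicI n k).indicator (fun _ => avgD g n k) x

/-- The dyadic square function on `ℝ`. -/
def sqFn (g : ℝ → ℝ) (x : ℝ) : ℝ :=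
  Real.sqrt (∑' q : ℤ × ℤ, (deltaD g q.1 q.2 x) ^ 2)

open Classical in
/-- The dyadic square function over `[0,1)`: the sum runs only over dyadic intervals
contained in `[0,1)`. -/
def sqFn01 (g : ℝ → ℝ) (x : ℝ) : ℝ :=
  Real.sqrt (∑' q : ℤ × ℤ,
    if dyadicI q.1 q.2 ⊆ Set.Ico (0:ℝ) 1 then (deltaD g q.1 q.2 x) ^ 2 else 0)

/-- `‖g‖_{L^p(w)}` (as an extended nonnegative real), `w dx` being the underlying measure. -/
def pNorm (p : ℝ) (g w : ℝ → ℝ) : ℝ≥0∞ :=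
  (∫⁻ x : ℝ, ENNReal.ofReal (|g x| ^ p * w x)) ^ (1/p)

/-- `‖g‖_{L^p(w)}` over `[0,1)`. -/
def pNorm01 (p : ℝ) (g w : ℝ → ℝ) : ℝ≥0∞ :=
  (∫⁻ x in Set.Ico (0:ℝ) 1, ENNReal.ofReal (|g x| ^ p * w x)) ^ (1/p)

/-- The joint `A_p` characteristic `[w,σ]_{A_p}`, the supremum running over all bounded
intervals of `ℝ`. -/
def apChar (p : ℝ) (w σ : ℝ → ℝ) : ℝ≥0∞ :=
  ⨆ (a : ℝ) (b : ℝ) (_ : a < b),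
    ENNReal.ofReal (avgI w a b * (avgI σ a b) ^ (p - 1))

/-- The joint `A_p` characteristic `[w,σ]_{A_p}`, the supremum running over all
subintervals of `[0,1)`. -/
def apChar01 (p : ℝ) (w σ : ℝ → ℝ) : ℝ≥0∞ :=
  ⨆ (a : ℝ) (b : ℝ) (_ : 0 ≤ a) (_ : a < b) (_ : b ≤ 1),
    ENNReal.ofReal (avgI w a b * (avgI σ a b) ^ (p - 1))

/-- The local maximal function `M_{[a,b)} σ (x) = sup { ⟨σ⟩_R : R interval ⊆ [a,b), x ∈ R }`. -/
def maxFn (σ : ℝ → ℝ) (a b x : ℝ) : ℝ≥0∞ :=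
  ⨆ (c : ℝ) (e : ℝ) (_ : a ≤ c) (_ : c < e) (_ : e ≤ b) (_ : x ∈ Set.Ico c e),
    ENNReal.ofReal (avgI σ c e)

/-- The Fujii–Wilson `A_∞` characteristic
`[σ]_{A_∞} = sup_Q (1/σ(Q)) ∫_Q M_Q σ`, the supremum over bounded intervals of `ℝ`. -/
def ainfChar (σ : ℝ → ℝ) : ℝ≥0∞ :=
  ⨆ (a : ℝ) (b : ℝ) (_ : a < b),
    (∫⁻ x in Set.Ico a b, maxFn σ a b x) / ENNReal.ofReal (∫ x in Set.Ico a b, σ x)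

/-- A weight on `ℝ`: measurable, a.e. positive, integrable over every bounded interval. -/
def IsWeight (w : ℝ → ℝ) : Prop :=
  Measurable w ∧ (∀ᵐ x : ℝ, 0 < w x) ∧
    ∀ a b : ℝ, a < b → IntegrableOn w (Set.Ico a b)

/-- A weight on `[0,1)`: measurable, a.e. positive on `[0,1)`, integrable over `[0,1)`. -/
def IsWeight01 (w : ℝ → ℝ) : Prop :=
  Measurable w ∧ (∀ᵐ x : ℝ, x ∈ Set.Ico (0:ℝ) 1 → 0 < w x) ∧
    IntegrableOn w (Set.Ico (0:ℝ) 1)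


theorem integral_abs_rpow_neg_swap (s a b : ℝ) :
    ∫ x in -b..-a, |x| ^ s = ∫ x in a..b, |x| ^ s := by
  rw [← intervalIntegral.integral_comp_neg]
  simp only [abs_neg]

theorem integral_Ico_ite_abs_rpow (s : ℝ) {a b : ℝ} (hab : a ≤ b) :
    ∫ x in Set.Ico a b, (if x = 0 then (1 : ℝ) else |x| ^ s) = ∫ x in a..b, |x| ^ s := by
  rw [intervalIntegral.integral_of_le hab, ← integral_Ico_eq_integral_Ioc]
  refine integral_congr_ae (ae_restrict_of_ae ?_)
  filter_upwards [Measure.ae_ne volume (0 : ℝ)] with x hx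
  simp [hx]

theorem avgI_ite_abs_rpow (s : ℝ) {a b : ℝ} (hab : a ≤ b) :
    avgI (fun x => if x = 0 then 1 else |x| ^ s) a b = (b - a)⁻¹ * ∫ x in a..b, |x| ^ s := by
  rw [avgI, integral_Ico_ite_abs_rpow s hab]

theorem intervalIntegrable_abs_rpow_zero_left {s b : ℝ} (hs : -1 < s) (hb : 0 ≤ b) :
    IntervalIntegrable (fun x => |x| ^ s) volume 0 b := by
  refine (intervalIntegral.intervalIntegrable_rpow' hs).congr ?_
  intro x hx
  rw [uIoc_of_le hb] at hx
  simp only [abs_of_pos hx.1]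

theorem intervalIntegrable_abs_rpow_zero_right {s a : ℝ} (hs : -1 < s) (ha : a ≤ 0) :
    IntervalIntegrable (fun x => |x| ^ s) volume a 0 := by
  rw [IntervalIntegrable.iff_comp_neg]
  simpa using (intervalIntegrable_abs_rpow_zero_left hs (neg_nonneg.2 ha)).symm

theorem integral_abs_rpow_of_nonneg {s a b : ℝ} (hs : -1 < s) (ha : 0 ≤ a) (hab : a ≤ b) :
    ∫ x in a..b, |x| ^ s = (b ^ (s + 1) - a ^ (s + 1)) / (s + 1) := by
  rw [← integral_rpow (Or.inl hs)]
  refine intervalIntegral.integral_congr fun x hx => ?_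
  rw [uIcc_of_le hab] at hx
  simp only [abs_of_nonneg (ha.trans hx.1)]

/-- Positive powers of `|x|`: the average over an interval is at most the maximum. -/
theorem inv_mul_integral_abs_rpow_le {s a b L : ℝ} (hs : 0 ≤ s) (hab : a < b)
    (haL : -L ≤ a) (hbL : b ≤ L) :
    (b - a)⁻¹ * ∫ x in a..b, |x| ^ s ≤ L ^ s := by
  have hint : IntervalIntegrable (fun x : ℝ => |x| ^ s) volume a b :=
    (continuous_abs.rpow_const fun _ => Or.inr hs).intervalIntegrable _ _
  have h := intervalIntegral.integral_mono_on hab.le hint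
    (intervalIntegrable_const (c := L ^ s)) fun x hx =>
      Real.rpow_le_rpow (abs_nonneg x) (abs_le.2 ⟨haL.trans hx.1, hx.2.trans hbL⟩) hs
  rw [intervalIntegral.integral_const, smul_eq_mul] at h
  rwa [inv_mul_le_iff₀ (sub_pos.2 hab)]

/-- Positive powers of `|x|`: the integral over an interval dominates the maximum times the
length. -/
theorem mul_max_rpow_le_integral_abs_rpow {s a b : ℝ} (hs : 0 ≤ s) (hab : a < b) :
    (b - a) / 4 * (max |a| |b| / 2) ^ s ≤ ∫ x in a..b, |x| ^ s := by
  wlog h : |a| ≤ |b| generalizing a b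
  · have := this (neg_lt_neg hab) (by simpa using (le_of_not_ge h))
    rw [integral_abs_rpow_neg_swap, abs_neg, abs_neg, max_comm] at this
    convert this using 3
    ring
  have hb : 0 < b := by
    by_contra! hb
    rw [abs_of_nonpos hb, abs_of_nonpos (hab.le.trans hb)] at h
    linarith
  rw [max_eq_right h, abs_of_pos hb]
  rw [abs_of_pos hb, abs_le] at h
  have hint : ∀ c d : ℝ, IntervalIntegrable (fun x : ℝ => |x| ^ s) volume c d := fun c d =>
    (continuous_abs.rpow_const fun _ => Or.inr hs).intervalIntegrable _ _
  have hle : b - (b - a) / 4 ≤ b := by linarith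
  have hright := intervalIntegral.integral_mono_on hle
    (intervalIntegrable_const (c := (b / 2) ^ s)) (hint _ _) fun x hx =>
      Real.rpow_le_rpow (by positivity)
        (show b / 2 ≤ |x| from le_trans (by linarith [hx.1]) (le_abs_self x)) hs
  have hleft : 0 ≤ ∫ x in a..b - (b - a) / 4, |x| ^ s :=
    intervalIntegral.integral_nonneg (by linarith) fun x _ => by positivity
  rw [intervalIntegral.integral_const, smul_eq_mul, sub_sub_cancel] at hright
  rw [← intervalIntegral.integral_add_adjacent_intervals (hint a (b - (b - a) / 4))
    (hint _ b)]
  linarith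

/-- Negative powers `|x| ^ (-β)`, `β < 1`: the average over an interval is controlled by the
minimum over the interval. -/
theorem inv_mul_integral_abs_rpow_neg_le {β a b : ℝ} (hβ0 : 0 < β) (hβ1 : β < 1) (hab : a < b) :
    (b - a)⁻¹ * ∫ x in a..b, |x| ^ (-β) ≤ 2 / (1 - β) * max |a| |b| ^ (-β) := by
  wlog h : |a| ≤ |b| generalizing a b
  · have := this (neg_lt_neg hab) (by simpa using (le_of_not_ge h))
    rw [integral_abs_rpow_neg_swap, abs_neg, abs_neg, max_comm] at this
    convert this using 3
    ring
  have hb : 0 < b := by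
    by_contra! hb
    rw [abs_of_nonpos hb, abs_of_nonpos (hab.le.trans hb)] at h
    linarith
  rw [max_eq_right h, abs_of_pos hb, inv_mul_le_iff₀ (sub_pos.2 hab)]
  rw [abs_of_pos hb, abs_le] at h
  have hβ : 0 < 1 - β := sub_pos.2 hβ1
  have hs : -1 < -β := by linarith
  have hmul : ∀ {x : ℝ}, 0 < x → x ^ (-β + 1) = x ^ (-β) * x := fun hx =>
    Real.rpow_add_one hx.ne' _
  have hrhs : (b - a) * (2 / (1 - β) * b ^ (-β)) = 2 * (b ^ (-β) * (b - a)) / (-β + 1) := by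
    rw [show -β + 1 = 1 - β by ring]
    ring
  have hbβ : 0 < b ^ (-β) := by positivity
  rw [hrhs]
  rcases lt_or_ge 0 a with ha | ha
  · rw [integral_abs_rpow_of_nonneg hs ha.le hab.le, hmul hb, hmul ha]
    have hanti : b ^ (-β) ≤ a ^ (-β) :=
      Real.rpow_le_rpow_of_nonpos ha hab.le (by linarith)
    have : 0 < -β + 1 := by linarith
    gcongr
    nlinarith [mul_le_mul_of_nonneg_right hanti ha.le, mul_pos hbβ (sub_pos.2 hab)]
  · have hz : (0 : ℝ) ^ (-β + 1) = 0 := Real.zero_rpow (by linarith)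
    have hsplit := intervalIntegral.integral_add_adjacent_intervals
      (intervalIntegrable_abs_rpow_zero_right hs ha)
      (intervalIntegrable_abs_rpow_zero_left hs hb.le)
    have hneg := integral_abs_rpow_neg_swap (-β) a 0
    rw [neg_zero, integral_abs_rpow_of_nonneg hs le_rfl (neg_nonneg.2 ha), hz] at hneg
    rw [← hsplit, ← hneg, integral_abs_rpow_of_nonneg hs le_rfl hb.le, hz, ← add_div]
    have hmono : (-a) ^ (-β + 1) ≤ b ^ (-β + 1) :=
      Real.rpow_le_rpow (neg_nonneg.2 ha) (by linarith [h.1]) (by linarith)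
    rw [hmul hb] at hmono ⊢
    have : 0 < -β + 1 := by linarith
    gcongr
    nlinarith [mul_nonneg hbβ.le (neg_nonneg.2 ha)]

theorem le_apChar_abs_rpow {p β : ℝ} (hp : 1 < p) (hβ0 : 0 < β) (hβ1 : β < 1) :
    ENNReal.ofReal (p⁻¹ * (1 - β) ^ (1 - p)) ≤
      apChar p (fun x => if x = 0 then 1 else |x| ^ (β * (p - 1)))
        (fun x => if x = 0 then 1 else |x| ^ (-β)) := by
  have hβ : 0 < 1 - β := sub_pos.2 hβ1
  have hγ : 0 < β * (p - 1) := mul_pos hβ0 (sub_pos.2 hp)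
  refine le_trans (ENNReal.ofReal_le_ofReal ?_)
    (le_iSup₂_of_le (0 : ℝ) 1 (le_iSup_of_le one_pos le_rfl))
  rw [avgI_ite_abs_rpow _ zero_le_one, avgI_ite_abs_rpow _ zero_le_one,
    integral_abs_rpow_of_nonneg (by linarith) le_rfl zero_le_one,
    integral_abs_rpow_of_nonneg (by linarith) le_rfl zero_le_one,
    Real.zero_rpow (by linarith), Real.zero_rpow (by linarith)]
  simp only [Real.one_rpow, sub_zero, inv_one, one_mul]
  rw [show -β + 1 = 1 - β by ring, one_div, one_div, Real.inv_rpow hβ.le, ← Real.rpow_neg hβ.le,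
    neg_sub]
  gcongr
  nlinarith

theorem apChar_abs_rpow_le {p β : ℝ} (hp : 1 < p) (hβ0 : 0 < β) (hβ1 : β < 1) :
    apChar p (fun x => if x = 0 then 1 else |x| ^ (β * (p - 1)))
        (fun x => if x = 0 then 1 else |x| ^ (-β)) ≤
      ENNReal.ofReal (2 ^ (p - 1) * (1 - β) ^ (1 - p)) := by
  have hβ : 0 < 1 - β := sub_pos.2 hβ1
  have hp' : 0 < p - 1 := sub_pos.2 hp
  refine iSup₂_le fun a b => iSup_le fun hab => ENNReal.ofReal_le_ofReal ?_
  rw [avgI_ite_abs_rpow _ hab.le, avgI_ite_abs_rpow _ hab.le]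
  set L := max |a| |b| with hL
  have hLpos : 0 < L := by
    rcases eq_or_ne a 0 with rfl | ha
    · exact lt_max_of_lt_right (abs_pos.2 hab.ne')
    · exact lt_max_of_lt_left (abs_pos.2 ha)
  have hw := inv_mul_integral_abs_rpow_le (mul_pos hβ0 hp').le hab
    (neg_le.1 ((neg_le_abs a).trans (le_max_left _ |b|)))
    ((le_abs_self b).trans (le_max_right |a| _))
  have hσ := inv_mul_integral_abs_rpow_neg_le hβ0 hβ1 hab
  have hσ0 : 0 ≤ (b - a)⁻¹ * ∫ x in a..b, |x| ^ (-β) :=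
    mul_nonneg (inv_nonneg.2 (sub_pos.2 hab).le)
      (intervalIntegral.integral_nonneg hab.le fun x _ => by positivity)
  calc _ ≤ L ^ (β * (p - 1)) * (2 / (1 - β) * L ^ (-β)) ^ (p - 1) :=
        mul_le_mul hw (Real.rpow_le_rpow hσ0 hσ hp'.le) (by positivity) (by positivity)
    _ = 2 ^ (p - 1) * (1 - β) ^ (1 - p) := by
        rw [Real.mul_rpow (by positivity) (by positivity), ← Real.rpow_mul hLpos.le,
          Real.div_rpow zero_le_two hβ.le, neg_mul, Real.rpow_neg hLpos.le,
          show 1 - p = -(p - 1) by ring, Real.rpow_neg hβ.le]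
        have : L ^ (β * (p - 1)) ≠ 0 := by positivity
        field_simp

theorem ainfChar_abs_rpow_le {s : ℝ} (hs : 0 ≤ s) :
    ainfChar (fun x => if x = 0 then 1 else |x| ^ s) ≤ ENNReal.ofReal (4 * 2 ^ s) := by
  refine iSup₂_le fun a b => iSup_le fun hab => ?_
  rw [integral_Ico_ite_abs_rpow s hab.le]
  set L := max |a| |b| with hL
  have hL0 : 0 ≤ L := le_max_of_le_left (abs_nonneg a)
  have hmax : ∀ x, maxFn (fun x => if x = 0 then 1 else |x| ^ s) a b x ≤
      ENNReal.ofReal (L ^ s) := by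
    refine fun x => iSup₂_le fun c e => iSup₂_le fun hac hce => iSup₂_le fun heb _ =>
      ENNReal.ofReal_le_ofReal ?_
    rw [avgI_ite_abs_rpow _ hce.le]
    exact inv_mul_integral_abs_rpow_le hs hce
      ((neg_le.1 ((neg_le_abs a).trans (le_max_left _ |b|))).trans hac)
      (heb.trans ((le_abs_self b).trans (le_max_right |a| _)))
  refine ENNReal.div_le_of_le_mul ?_
  calc ∫⁻ x in Set.Ico a b, maxFn (fun x => if x = 0 then 1 else |x| ^ s) a b x
      ≤ ∫⁻ _ in Set.Ico a b, ENNReal.ofReal (L ^ s) := lintegral_mono hmax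
    _ = ENNReal.ofReal (L ^ s * (b - a)) := by
        rw [setLIntegral_const, Real.volume_Ico, ENNReal.ofReal_mul (by positivity)]
    _ ≤ ENNReal.ofReal (4 * 2 ^ s * ∫ x in a..b, |x| ^ s) := by
        refine ENNReal.ofReal_le_ofReal ?_
        have h := mul_max_rpow_le_integral_abs_rpow hs hab
        rw [← hL, Real.div_rpow hL0 zero_le_two] at h
        calc L ^ s * (b - a) = 4 * 2 ^ s * ((b - a) / 4 * (L ^ s / 2 ^ s)) := by
              field_simp
          _ ≤ _ := by gcongr
    _ = _ := ENNReal.ofReal_mul (by positivity)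

/-- For `β ∈ (0,1)`, `p ∈ (1,∞)` and the weights `σ(x) = |x|^{-β}`,
`w(x) = |x|^{β(p-1)}` (with `w(0) = σ(0) = 1`), one has `[w,σ]_{A_p} ≍ (1-β)^{1-p}`
with comparability constants depending only on `p`; moreover `[w]_{A_∞} ≤ C(p)` for a
constant depending only on `p`. -/
theorem statement4 (p : ℝ) (hp : 1 < p) :
    ∃ c > (0:ℝ), ∃ C > (0:ℝ), ∃ Cp > (0:ℝ), ∀ β ∈ Set.Ioo (0:ℝ) 1,
      ENNReal.ofReal (c * (1 - β) ^ (1 - p)) ≤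
          apChar p (fun x => if x = 0 then 1 else |x| ^ (β * (p - 1)))
            (fun x => if x = 0 then 1 else |x| ^ (-β)) ∧
      apChar p (fun x => if x = 0 then 1 else |x| ^ (β * (p - 1)))
          (fun x => if x = 0 then 1 else |x| ^ (-β)) ≤
        ENNReal.ofReal (C * (1 - β) ^ (1 - p)) ∧
      ainfChar (fun x => if x = 0 then 1 else |x| ^ (β * (p - 1))) ≤
        ENNReal.ofReal Cp := by
  refine ⟨p⁻¹, by positivity, 2 ^ (p - 1), by positivity, 4 * 2 ^ (p - 1), by positivity, ?_⟩
  rintro β ⟨hβ0, hβ1⟩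
  have hp' : 0 < p - 1 := sub_pos.2 hp
  refine ⟨le_apChar_abs_rpow hp hβ0 hβ1, apChar_abs_rpow_le hp hβ0 hβ1,
    (ainfChar_abs_rpow_le (by positivity)).trans (ENNReal.ofReal_le_ofReal ?_)⟩
  gcongr
  · exact one_le_two
  · nlinarith

end
end

section
/- Let p ∈ (1,∞) and set I_k = [0, 2^{−k}) for k = 0,1,2,…. Let w, σ be weights on [0,1) such that: (i) [w,σ]_{A_p} ≤ C₁(p); (ii) w(I_k) σ(I_l)^{p−1} ≤ C₂(p) (|I_k| + |I_l|)^p for all k,l ≥ 0; (iii) there exists x₀ ∈ [1/2, 1) (depending only on p) with w(x) ≤ C₃(p) and σ(x) ≤ C₃(p) for all x ∈ [x₀,1). Define weights w̃, σ̃ on ℝ by, for each k ∈ ℤ: w̃(x) = w(x−k+1) for x ∈ (k−1,k) if k is odd, w̃(x) = w(k−x) for x ∈ (k−1,k) if k is even, and similarly for σ̃ from σ, with w̃(k) = σ̃(k) = 1 at integers. Then [w̃, σ̃]_{A_p} ≤ C(p) for a constant depending only on p (and on C₁, C₂, C₃, x₀). -/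
open MeasureTheory Set Filter
open scoped ENNReal NNReal

noncomputable section

open Classical in
/-- The extension of a weight `w` on `[0,1)` to the whole line, by alternating
reflections: on `(k-1, k)` it equals `w(x-k+1)` for odd `k` and `w(k-x)` for even `k`,
and it equals `1` at the integers. -/
def extend01 (w : ℝ → ℝ) (x : ℝ) : ℝ :=
  if (⌈x⌉ : ℝ) = x then 1
  else if Odd ⌈x⌉ then w (x - (⌈x⌉ : ℝ) + 1) else w ((⌈x⌉ : ℝ) - x)

/-- On `(n, n + 1)` with `n` even, the extension is a translate of the weight. -/
lemma extend01_of_even (w : ℝ → ℝ) {n : ℤ} (hn : Even n) {x : ℝ}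
    (h₁ : (n : ℝ) < x) (h₂ : x < n + 1) : extend01 w x = w (x - n) := by
  have hc : ⌈x⌉ = n + 1 := by
    rw [Int.ceil_eq_iff]
    push_cast
    exact ⟨by linarith, h₂.le⟩
  have hodd : Odd (n + 1) := hn.add_one
  unfold extend01
  rw [hc, if_neg (by push_cast; exact h₂.ne'), if_pos hodd]
  congr 1
  push_cast
  ring

/-- On `(n, n + 1)` with `n` odd, the extension is a reflection of the weight. -/
lemma extend01_of_odd (w : ℝ → ℝ) {n : ℤ} (hn : Odd n) {x : ℝ}
    (h₁ : (n : ℝ) < x) (h₂ : x < n + 1) : extend01 w x = w (n + 1 - x) := by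
  have hc : ⌈x⌉ = n + 1 := by
    rw [Int.ceil_eq_iff]
    push_cast
    exact ⟨by linarith, h₂.le⟩
  have hodd : ¬ Odd (n + 1) := Int.not_odd_iff_even.2 hn.add_one
  unfold extend01
  rw [hc, if_neg (by push_cast; exact h₂.ne'), if_neg hodd]
  congr 1
  push_cast
  ring

lemma setLIntegral_extend01_of_even (w : ℝ → ℝ) {n : ℤ} (hn : Even n) {c d : ℝ}
    (hc : (n : ℝ) ≤ c) (hd : d ≤ n + 1) :
    ∫⁻ x in Ico c d, ENNReal.ofReal (extend01 w x) =
      ∫⁻ x in Ico (c - n) (d - n), ENNReal.ofReal (w x) := by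
  rw [setLIntegral_congr (Ioo_ae_eq_Ico (a := c)).symm,
    setLIntegral_congr (Ioo_ae_eq_Ico (a := c - n)).symm,
    ← (measurePreserving_sub_right volume (n : ℝ)).setLIntegral_comp_preimage_emb
    (MeasurableEquiv.subRight (n : ℝ)).measurableEmbedding (fun x => ENNReal.ofReal (w x))]
  simp only [preimage_sub_const_Ioo, sub_add_cancel]
  refine setLIntegral_congr_fun measurableSet_Ioo fun x hx => ?_
  rw [extend01_of_even w hn (hc.trans_lt hx.1) (hx.2.trans_le hd)]

lemma setLIntegral_extend01_of_odd (w : ℝ → ℝ) {n : ℤ} (hn : Odd n) {c d : ℝ}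
    (hc : (n : ℝ) ≤ c) (hd : d ≤ n + 1) :
    ∫⁻ x in Ico c d, ENNReal.ofReal (extend01 w x) =
      ∫⁻ x in Ico (n + 1 - d) (n + 1 - c), ENNReal.ofReal (w x) := by
  rw [setLIntegral_congr (Ioo_ae_eq_Ico (a := c)).symm,
    setLIntegral_congr (Ioo_ae_eq_Ico (a := n + 1 - d)).symm,
    ← (Measure.measurePreserving_sub_left volume (n + 1 : ℝ)).setLIntegral_comp_preimage_emb
    (MeasurableEquiv.subLeft (n + 1 : ℝ)).measurableEmbedding (fun x => ENNReal.ofReal (w x))]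
  simp only [preimage_const_sub_Ioo, sub_sub_cancel]
  refine setLIntegral_congr_fun measurableSet_Ioo fun x hx => ?_
  rw [extend01_of_odd w hn (hc.trans_lt hx.1) (hx.2.trans_le hd)]

lemma measurable_extend01 {w : ℝ → ℝ} (hw : Measurable w) : Measurable (extend01 w) := by
  unfold extend01
  have hc : Measurable fun x : ℝ => (⌈x⌉ : ℝ) := by fun_prop
  refine Measurable.ite (measurableSet_eq_fun hc measurable_id) measurable_const ?_
  refine Measurable.ite ?_ (by fun_prop) (by fun_prop)
  exact Int.measurable_ceil (MeasurableSet.of_discrete (s := {k : ℤ | Odd k}))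

lemma extend01_nonneg_ae {w : ℝ → ℝ} (hw : ∀ᵐ x : ℝ, x ∈ Ico (0 : ℝ) 1 → 0 < w x) :
    ∀ᵐ x : ℝ, 0 ≤ extend01 w x := by
  have h₁ : ∀ᵐ x : ℝ, ∀ n : ℤ, x - n ∈ Ico (0 : ℝ) 1 → 0 < w (x - n) :=
    ae_all_iff.2 fun n =>
      (measurePreserving_sub_right volume (n : ℝ)).quasiMeasurePreserving.ae hw
  have h₂ : ∀ᵐ x : ℝ, ∀ n : ℤ, (n + 1 : ℝ) - x ∈ Ico (0 : ℝ) 1 → 0 < w (n + 1 - x) :=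
    ae_all_iff.2 fun n =>
      (Measure.measurePreserving_sub_left volume (n + 1 : ℝ)).quasiMeasurePreserving.ae hw
  filter_upwards [h₁, h₂] with x h₁ h₂
  rcases (Int.floor_le x).eq_or_lt with h | h
  · have hc : (⌈x⌉ : ℝ) = x := by rw [← h, Int.ceil_intCast]
    simp [extend01, hc]
  · have h' := Int.lt_floor_add_one x
    rcases Int.even_or_odd ⌊x⌋ with hn | hn
    · rw [extend01_of_even w hn h h']
      exact (h₁ _ ⟨by linarith, by linarith⟩).le
    · rw [extend01_of_odd w hn h h']
      exact (h₂ _ ⟨by linarith, by linarith⟩).le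

/-- Every bounded interval folds onto a subinterval of `[0, 1)` of comparable length, with
multiplicity at most three times the ratio of the lengths. -/
lemma exists_setLIntegral_extend01_le {a b : ℝ} (hab : a < b) :
    ∃ c d : ℝ, 0 ≤ c ∧ c < d ∧ d ≤ 1 ∧ ∀ w : ℝ → ℝ,
      ∫⁻ x in Ico a b, ENNReal.ofReal (extend01 w x) ≤
        ENNReal.ofReal (3 * (b - a) / (d - c)) * ∫⁻ x in Ico c d, ENNReal.ofReal (w x) := by
  have hfl := Int.floor_le a
  have hlt := Int.lt_floor_add_one a
  rcases le_or_gt b (⌊a⌋ + 1) with hb | hb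
  · have h3 : (1 : ℝ≥0∞) ≤ ENNReal.ofReal (3 * (b - a) / (b - a)) := by
      rw [mul_div_cancel_right₀ _ (sub_pos.2 hab).ne']
      simp
    rcases Int.even_or_odd ⌊a⌋ with hn | hn
    · refine ⟨a - ⌊a⌋, b - ⌊a⌋, by linarith, by linarith, by linarith, fun w => ?_⟩
      rw [setLIntegral_extend01_of_even w hn hfl hb, sub_sub_sub_cancel_right]
      exact le_mul_of_one_le_left' h3
    · refine ⟨⌊a⌋ + 1 - b, ⌊a⌋ + 1 - a, by linarith, by linarith, by linarith, fun w => ?_⟩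
      rw [setLIntegral_extend01_of_odd w hn hfl hb, sub_sub_sub_cancel_left]
      exact le_mul_of_one_le_left' h3
  rcases lt_or_ge (b - a) 1 with hL | hL
  · obtain ⟨n, hna, hnb⟩ : ∃ n : ℤ, a < n ∧ (n : ℝ) < b :=
      ⟨⌊a⌋ + 1, by push_cast; exact hlt, by push_cast; exact hb⟩
    obtain ⟨M, hM0, hML, hMa, hMb⟩ : ∃ M : ℝ, 0 < M ∧ M ≤ b - a ∧ n - a ≤ M ∧ b - n ≤ M :=
      ⟨max (n - a) (b - n), lt_max_of_lt_left (by linarith),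
        max_le (by linarith) (by linarith), le_max_left _ _, le_max_right _ _⟩
    have hsub : Ico a b ⊆ Ico ((n : ℝ) - M) n ∪ Ico (n : ℝ) (n + M) := by
      intro x hx
      rcases lt_or_ge x n with h | h
      · exact Or.inl ⟨by linarith [hx.1], h⟩
      · exact Or.inr ⟨h, by linarith [hx.2]⟩
    have hle : ∀ w : ℝ → ℝ, ∫⁻ x in Ico a b, ENNReal.ofReal (extend01 w x) ≤
        (∫⁻ x in Ico ((n : ℝ) - M) n, ENNReal.ofReal (extend01 w x)) +
          ∫⁻ x in Ico (n : ℝ) (n + M), ENNReal.ofReal (extend01 w x) := fun w =>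
      (lintegral_mono_set hsub).trans (lintegral_union_le _ _ _)
    have h2 : (2 : ℝ≥0∞) ≤ ENNReal.ofReal (3 * (b - a) / M) := by
      rw [← ENNReal.ofReal_ofNat]
      refine ENNReal.ofReal_le_ofReal ?_
      rw [le_div_iff₀ hM0]
      linarith
    have hcast : ((n - 1 : ℤ) : ℝ) = n - 1 := by push_cast; ring
    rcases Int.even_or_odd n with hn | hn
    · refine ⟨0, M, le_rfl, hM0, by linarith, fun w => (hle w).trans ?_⟩
      have hn' : Odd (n - 1) := hn.sub_odd odd_one
      rw [setLIntegral_extend01_of_even w hn le_rfl (by linarith),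
        setLIntegral_extend01_of_odd w hn' (by rw [hcast]; linarith) (by rw [hcast]; linarith),
        hcast, show (n : ℝ) - 1 + 1 - n = 0 by ring, show (n : ℝ) - 1 + 1 - (n - M) = M by ring,
        sub_self, add_sub_cancel_left, sub_zero, ← two_mul]
      gcongr
    · refine ⟨1 - M, 1, by linarith, by linarith, le_rfl, fun w => (hle w).trans ?_⟩
      have hn' : Even (n - 1) := hn.sub_odd odd_one
      rw [setLIntegral_extend01_of_odd w hn le_rfl (by linarith),
        setLIntegral_extend01_of_even w hn' (by rw [hcast]; linarith) (by rw [hcast]; linarith),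
        hcast, show (n : ℝ) - M - (n - 1) = 1 - M by ring, show (n : ℝ) - (n - 1) = 1 by ring,
        show (n : ℝ) + 1 - (n + M) = 1 - M by ring, show (n : ℝ) + 1 - n = 1 by ring,
        sub_sub_cancel, ← two_mul]
      gcongr
  · refine ⟨0, 1, le_rfl, one_pos, le_rfl, fun w => ?_⟩
    have hcell : ∀ n : ℤ, ∫⁻ x in Ico (n : ℝ) (n + 1), ENNReal.ofReal (extend01 w x) =
        ∫⁻ x in Ico (0 : ℝ) 1, ENNReal.ofReal (w x) := by
      intro n
      rcases Int.even_or_odd n with hn | hn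
      · rw [setLIntegral_extend01_of_even w hn le_rfl le_rfl]
        simp
      · rw [setLIntegral_extend01_of_odd w hn le_rfl le_rfl]
        simp
    have hsub : Ico a b ⊆ ⋃ n ∈ Finset.Ico ⌊a⌋ ⌈b⌉, Ico (n : ℝ) (n + 1) := by
      intro x hx
      simp only [mem_iUnion, Finset.mem_Ico]
      exact ⟨⌊x⌋, ⟨Int.floor_le_floor hx.1, Int.floor_lt_ceil_of_lt hx.2⟩,
        Int.floor_le x, Int.lt_floor_add_one x⟩
    have hcard : ((Finset.Ico ⌊a⌋ ⌈b⌉).card : ℝ) ≤ 3 * (b - a) / (1 - 0) := by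
      have hfc : ⌊a⌋ ≤ ⌈b⌉ := (Int.floor_lt_ceil_of_lt hab).le
      have h : ((Finset.Ico ⌊a⌋ ⌈b⌉).card : ℝ) = ⌈b⌉ - ⌊a⌋ := by
        have := Int.toNat_of_nonneg (sub_nonneg.2 hfc)
        rw [Int.card_Ico]
        exact_mod_cast this
      have := Int.ceil_lt_add_one b
      rw [h, sub_zero, div_one]
      linarith
    calc ∫⁻ x in Ico a b, ENNReal.ofReal (extend01 w x)
        ≤ ∫⁻ x in ⋃ n ∈ Finset.Ico ⌊a⌋ ⌈b⌉, Ico (n : ℝ) (n + 1),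
            ENNReal.ofReal (extend01 w x) := lintegral_mono_set hsub
      _ ≤ ∑ n ∈ Finset.Ico ⌊a⌋ ⌈b⌉, ∫⁻ x in Ico (n : ℝ) (n + 1),
            ENNReal.ofReal (extend01 w x) := by
          simp only [← withDensity_apply _ measurableSet_Ico]
          rw [← withDensity_apply _ (Finset.measurableSet_biUnion _ fun _ _ => measurableSet_Ico)]
          exact measure_biUnion_finset_le _ _
      _ = ENNReal.ofReal ((Finset.Ico ⌊a⌋ ⌈b⌉).card : ℝ) *
            ∫⁻ x in Ico (0 : ℝ) 1, ENNReal.ofReal (w x) := by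
          simp only [hcell, Finset.sum_const, nsmul_eq_mul, ENNReal.ofReal_natCast]
      _ ≤ _ := by gcongr

lemma avgI_extend01_nonneg {w : ℝ → ℝ} (hw : IsWeight01 w) {a b : ℝ} (hab : a < b) :
    0 ≤ avgI (extend01 w) a b :=
  mul_nonneg (inv_nonneg.2 (sub_pos.2 hab).le)
    (integral_nonneg_of_ae (ae_restrict_of_ae (extend01_nonneg_ae hw.2.1)))

lemma avgI_nonneg_of_isWeight01 {w : ℝ → ℝ} (hw : IsWeight01 w) {c d : ℝ}
    (hc : 0 ≤ c) (hcd : c < d) (hd : d ≤ 1) : 0 ≤ avgI w c d := by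
  refine mul_nonneg (inv_nonneg.2 (sub_pos.2 hcd).le)
    (setIntegral_nonneg_of_ae_restrict ?_)
  filter_upwards [ae_restrict_of_ae hw.2.1, ae_restrict_mem measurableSet_Ico] with x hx hmem
  exact (hx ⟨hc.trans hmem.1, hmem.2.trans_le hd⟩).le

/-- Averages of the extension over `[a, b)` are controlled by averages of the weight over a
subinterval of `[0, 1)` that depends only on `a` and `b`. -/
lemma exists_avgI_extend01_le {a b : ℝ} (hab : a < b) :
    ∃ c d : ℝ, 0 ≤ c ∧ c < d ∧ d ≤ 1 ∧ ∀ w : ℝ → ℝ, IsWeight01 w →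
      avgI (extend01 w) a b ≤ 3 * avgI w c d := by
  obtain ⟨c, d, hc, hcd, hd, h⟩ := exists_setLIntegral_extend01_le hab
  refine ⟨c, d, hc, hcd, hd, fun w hw => ?_⟩
  have hba : 0 < b - a := sub_pos.2 hab
  have hdc : 0 < d - c := sub_pos.2 hcd
  have hsub : Ico c d ⊆ Ico 0 1 := Ico_subset_Ico hc hd
  have hpos : 0 ≤ᵐ[volume.restrict (Ico c d)] w := by
    filter_upwards [ae_restrict_of_ae hw.2.1, ae_restrict_mem measurableSet_Ico] with x hx hmem
    exact (hx (hsub hmem)).le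
  have hint : IntegrableOn w (Ico c d) := hw.2.2.mono_set hsub
  have key : ∫ x in Ico a b, extend01 w x ≤ 3 * (b - a) / (d - c) * ∫ x in Ico c d, w x := by
    have h0 : 0 ≤ 3 * (b - a) / (d - c) := by positivity
    rw [integral_eq_lintegral_of_nonneg_ae (ae_restrict_of_ae (extend01_nonneg_ae hw.2.1))
      (measurable_extend01 hw.1).aestronglyMeasurable]
    refine ENNReal.toReal_le_of_le_ofReal (mul_nonneg h0 (integral_nonneg_of_ae hpos)) ?_
    rw [ENNReal.ofReal_mul h0, ofReal_integral_eq_lintegral_ofReal hint hpos]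
    exact h w
  calc avgI (extend01 w) a b
      ≤ (b - a)⁻¹ * (3 * (b - a) / (d - c) * ∫ x in Ico c d, w x) := by
        unfold avgI
        gcongr
    _ = 3 * avgI w c d := by
        unfold avgI
        field_simp

/-- Let `p ∈ (1,∞)`, `I_k = [0,2^{-k})`. If weights `w, σ` on `[0,1)`
satisfy (i) `[w,σ]_{A_p} ≤ C₁`, (ii) `w(I_k) σ(I_l)^{p-1} ≤ C₂ (|I_k|+|I_l|)^p` for all
`k, l ≥ 0`, and (iii) `w, σ ≤ C₃` on `[x₀, 1)` for some `x₀ ∈ [1/2,1)`, then the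
reflected extensions `w̃, σ̃` to `ℝ` satisfy `[w̃,σ̃]_{A_p} ≤ C` with `C` depending only
on `p` (and `C₁, C₂, C₃, x₀`). -/
theorem statement5 (p : ℝ) (hp : 1 < p) (C₁ C₂ C₃ : ℝ) (hC₁ : 0 < C₁) (hC₂ : 0 < C₂)
    (hC₃ : 0 < C₃) (x₀ : ℝ) (hx₀ : x₀ ∈ Set.Ico (1/2 : ℝ) 1) :
    ∃ C > (0:ℝ), ∀ w σ : ℝ → ℝ, IsWeight01 w → IsWeight01 σ →
      apChar01 p w σ ≤ ENNReal.ofReal C₁ →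
      (∀ k l : ℕ,
        (∫ x in Set.Ico (0:ℝ) ((2:ℝ) ^ (-(k:ℤ))), w x) *
            (∫ x in Set.Ico (0:ℝ) ((2:ℝ) ^ (-(l:ℤ))), σ x) ^ (p - 1) ≤
          C₂ * ((2:ℝ) ^ (-(k:ℤ)) + (2:ℝ) ^ (-(l:ℤ))) ^ p) →
      (∀ x ∈ Set.Ico x₀ 1, w x ≤ C₃ ∧ σ x ≤ C₃) →
      apChar p (extend01 w) (extend01 σ) ≤ ENNReal.ofReal C := by
  refine ⟨3 ^ p * C₁, by positivity, fun w σ hw hσ hA _ _ => ?_⟩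
  unfold apChar
  refine iSup_le fun a => iSup_le fun b => iSup_le fun hab => ?_
  obtain ⟨c, d, hc, hcd, hd, h⟩ := exists_avgI_extend01_le hab
  have hcA : avgI w c d * avgI σ c d ^ (p - 1) ≤ C₁ := by
    rw [← ENNReal.ofReal_le_ofReal_iff hC₁.le]
    refine le_trans ?_ hA
    unfold apChar01
    exact le_iSup_of_le c (le_iSup_of_le d (le_iSup_of_le hc (le_iSup_of_le hcd
      (le_iSup_of_le hd le_rfl))))
  have hw0 := avgI_nonneg_of_isWeight01 hw hc hcd hd
  have hσ0 := avgI_nonneg_of_isWeight01 hσ hc hcd hd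
  refine ENNReal.ofReal_le_ofReal ?_
  calc avgI (extend01 w) a b * avgI (extend01 σ) a b ^ (p - 1)
      ≤ (3 * avgI w c d) * (3 * avgI σ c d) ^ (p - 1) :=
        mul_le_mul (h w hw)
          (Real.rpow_le_rpow (avgI_extend01_nonneg hσ hab) (h σ hσ) (by linarith))
          (Real.rpow_nonneg (avgI_extend01_nonneg hσ hab) _) (by positivity)
    _ = 3 ^ p * (avgI w c d * avgI σ c d ^ (p - 1)) := by
        rw [Real.mul_rpow (by norm_num) hσ0, Real.rpow_sub_one (by norm_num : (3 : ℝ) ≠ 0)]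
        ring
    _ ≤ 3 ^ p * C₁ := by gcongr

end
end

section
/- Let p ∈ (1,∞) and β ∈ (1/2, 1). Let σ(x) = |x|^{−β}, w(x) = |x|^{β(p−1)} for x ≠ 0 (σ(0)=w(0)=1), and f = 1_{[0,1]}. Then ‖S(σf)‖_{L^p(w)} ≥ c_p (1−β)^{−1−1/p}, where c_p > 0 depends only on p and S is the dyadic square function on ℝ. -/
open MeasureTheory Set Filter
open scoped ENNReal NNReal

noncomputable section

theorem mem_dyadicI_iff (n k : ℤ) (x : ℝ) : x ∈ dyadicI n k ↔ k = ⌊x * (2:ℝ) ^ n⌋ := by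
  have h2 : (0:ℝ) < 2 ^ n := by positivity
  rw [eq_comm, Int.floor_eq_iff, dyadicI, Set.mem_Ico, zpow_neg, ← div_eq_mul_inv,
    ← div_eq_mul_inv, div_le_iff₀ h2, lt_div_iff₀ h2]

theorem floor_mul_zpow_succ (x : ℝ) (n : ℤ) :
    ⌊x * (2:ℝ) ^ (n + 1)⌋ = 2 * ⌊x * (2:ℝ) ^ n⌋ ∨
      ⌊x * (2:ℝ) ^ (n + 1)⌋ = 2 * ⌊x * (2:ℝ) ^ n⌋ + 1 := by
  have e : x * (2:ℝ) ^ (n + 1) = 2 * (x * (2:ℝ) ^ n) := by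
    rw [zpow_add_one₀ (two_ne_zero)]; ring
  rw [e]
  set y := x * (2:ℝ) ^ n
  have h1 := Int.floor_le y
  have h2 := Int.lt_floor_add_one y
  have h3 : 2 * ⌊y⌋ ≤ ⌊2 * y⌋ := by
    rw [Int.le_floor]; push_cast; linarith
  have h4 : ⌊2 * y⌋ < 2 * ⌊y⌋ + 2 := by
    rw [Int.floor_lt]; push_cast; linarith
  omega

/-- On the dyadic interval containing `x`, the martingale difference at `x` is the difference of
the averages at two consecutive scales. -/
theorem deltaD_floor (g : ℝ → ℝ) (n : ℤ) (x : ℝ) :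
    deltaD g n ⌊x * (2:ℝ) ^ n⌋ x =
      avgD g (n + 1) ⌊x * (2:ℝ) ^ (n + 1)⌋ - avgD g n ⌊x * (2:ℝ) ^ n⌋ := by
  classical
  simp only [deltaD, Set.indicator_apply, mem_dyadicI_iff, if_true]
  rcases floor_mul_zpow_succ x n with h | h <;> rw [h] <;> simp

theorem deltaD_eq_zero (g : ℝ → ℝ) {n k : ℤ} {x : ℝ} (hk : k ≠ ⌊x * (2:ℝ) ^ n⌋) :
    deltaD g n k x = 0 := by
  classical
  have h0 : 2 * k ≠ ⌊x * (2:ℝ) ^ (n + 1)⌋ := by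
    rcases floor_mul_zpow_succ x n with h | h <;> omega
  have h1 : 2 * k + 1 ≠ ⌊x * (2:ℝ) ^ (n + 1)⌋ := by
    rcases floor_mul_zpow_succ x n with h | h <;> omega
  simp only [deltaD, Set.indicator_apply, mem_dyadicI_iff, if_neg hk, if_neg h0, if_neg h1]
  simp

theorem avgD_eq (g : ℝ → ℝ) (n k : ℤ) :
    avgD g n k = (2:ℝ) ^ n * ∫ x in dyadicI n k, g x := by
  rw [avgD, avgI, dyadicI]
  congr 1
  rw [add_mul, add_sub_cancel_left, one_mul, zpow_neg, inv_inv]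

theorem abs_avgD_le {g : ℝ → ℝ} (hg : Integrable g) (n k : ℤ) :
    |avgD g n k| ≤ (2:ℝ) ^ n * ∫ x, |g x| := by
  have h2 : (0:ℝ) < 2 ^ n := by positivity
  rw [avgD_eq, abs_mul, abs_of_pos h2]
  gcongr
  refine (abs_integral_le_integral_abs).trans ?_
  exact setIntegral_le_integral hg.abs (Eventually.of_forall fun x => abs_nonneg (g x))

theorem volume_real_dyadicI (n k : ℤ) : volume.real (dyadicI n k) = (2:ℝ) ^ (-n) := by
  have h2 : (0:ℝ) < 2 ^ (-n) := by positivity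
  rw [dyadicI, Real.volume_real_Ico_of_le (by nlinarith)]
  ring

/-- The average over the dyadic interval of length `2⁻ⁿ` containing `x` is within `C * 2⁻ⁿ` of
`g x` when `g` satisfies a Lipschitz condition at `x` at that scale. -/
theorem abs_avgD_sub_le {g : ℝ → ℝ} (hg : Integrable g) {x C : ℝ} (hC : 0 ≤ C) (n : ℤ)
    (hx : ∀ y, |y - x| ≤ (2:ℝ) ^ (-n) → |g y - g x| ≤ C * |y - x|) :
    |avgD g n ⌊x * (2:ℝ) ^ n⌋ - g x| ≤ C * (2:ℝ) ^ (-n) := by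
  set k := ⌊x * (2:ℝ) ^ n⌋ with hk
  have h2 : (0:ℝ) < 2 ^ n := by positivity
  have hv := volume_real_dyadicI n k
  have hfin : volume (dyadicI n k) < ∞ := by
    rw [dyadicI]; exact measure_Ico_lt_top
  have hmem : x ∈ dyadicI n k := (mem_dyadicI_iff n k x).2 hk
  have e : avgD g n k - g x = (2:ℝ) ^ n * ∫ y in dyadicI n k, (g y - g x) := by
    rw [integral_sub hg.integrableOn (integrableOn_const hfin.ne), setIntegral_const, hv, avgD_eq,
      smul_eq_mul, mul_sub, ← mul_assoc, zpow_neg, mul_inv_cancel₀ h2.ne', one_mul]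
  have hb : ‖∫ y in dyadicI n k, (g y - g x)‖ ≤ (C * 2 ^ (-n)) * volume.real (dyadicI n k) := by
    refine norm_setIntegral_le_of_norm_le_const hfin fun y hy => ?_
    have hyx : |y - x| ≤ (2:ℝ) ^ (-n) := by
      rw [dyadicI, Set.mem_Ico] at hy hmem
      rw [abs_le]
      constructor <;> linarith [hy.1, hy.2, hmem.1, hmem.2]
    exact (hx y hyx).trans (mul_le_mul_of_nonneg_left hyx hC)
  rw [e, abs_mul, abs_of_pos h2]
  calc (2:ℝ) ^ n * |∫ y in dyadicI n k, (g y - g x)|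
      ≤ 2 ^ n * ((C * 2 ^ (-n)) * volume.real (dyadicI n k)) := by gcongr; exact hb
    _ = C * 2 ^ (-n) := by
      rw [hv, zpow_neg]; field_simp

/-- The series defining the square function of an integrable function converges at every point of
differentiability. -/
theorem summable_deltaD_sq {g : ℝ → ℝ} (hg : Integrable g) {x : ℝ} (hx : DifferentiableAt ℝ g x) :
    Summable fun q : ℤ × ℤ => (deltaD g q.1 q.2 x) ^ 2 := by
  have hinj : Function.Injective fun n : ℤ => (n, ⌊x * (2:ℝ) ^ n⌋) :=
    fun a b h => congrArg Prod.fst h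
  rw [← hinj.summable_iff]
  swap
  · rintro ⟨n, k⟩ hq
    have hk : k ≠ ⌊x * (2:ℝ) ^ n⌋ := fun h => hq ⟨n, by simp [h]⟩
    simp [deltaD_eq_zero g hk]
  have hgeo : Summable fun n : ℕ => ((1:ℝ) / 4) ^ n :=
    summable_geometric_of_lt_one (by norm_num) (by norm_num)
  have hpow : ∀ n : ℕ, ((2:ℝ) ^ (-(n:ℤ))) ^ 2 = ((1:ℝ) / 4) ^ n := by
    intro n
    rw [zpow_neg, zpow_natCast, ← inv_pow, ← pow_mul, mul_comm, pow_mul]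
    norm_num
  have key : ∀ (a : ℕ → ℝ) (K : ℝ), (∀ᶠ n : ℕ in atTop, |a n| ≤ K * 2 ^ (-(n:ℤ))) →
      Summable fun n => a n ^ 2 := by
    intro a K h
    refine summable_of_isBigO_nat hgeo (Asymptotics.IsBigO.of_bound (K ^ 2) ?_)
    filter_upwards [h] with n hn
    rw [← hpow, Real.norm_of_nonneg (sq_nonneg _), Real.norm_of_nonneg (sq_nonneg _), ← mul_pow,
      ← sq_abs (a n)]
    gcongr
  refine Summable.of_nat_of_neg ?_ ?_
  · simp only [Function.comp_def, deltaD_floor]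
    obtain ⟨C, hC, hO⟩ := hx.hasDerivAt.isBigO_sub.exists_pos
    obtain ⟨δ, hδ, hball⟩ := Metric.eventually_nhds_iff.1 hO.bound
    refine key _ (2 * C) ?_
    have hlim : Tendsto (fun n : ℕ => (2:ℝ) ^ (-(n:ℤ))) atTop (nhds 0) := by
      simpa [zpow_neg, ← inv_pow] using
        tendsto_pow_atTop_nhds_zero_of_lt_one (r := (2:ℝ)⁻¹) (by norm_num) (by norm_num)
    filter_upwards [hlim.eventually (gt_mem_nhds hδ)] with n hn
    have hstep : (2:ℝ) ^ (-((n:ℤ) + 1)) ≤ 2 ^ (-(n:ℤ)) :=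
      zpow_le_zpow_right₀ (by norm_num) (by omega)
    have h1 := abs_avgD_sub_le hg hC.le (n : ℤ) fun y hy => by
      simpa [Real.norm_eq_abs] using hball (y := y) (by rw [Real.dist_eq]; linarith)
    have h2 := abs_avgD_sub_le hg hC.le ((n : ℤ) + 1) fun y hy => by
      simpa [Real.norm_eq_abs] using hball (y := y) (by rw [Real.dist_eq]; linarith)
    have h3 := mul_le_mul_of_nonneg_left hstep hC.le
    have h4 := abs_sub_le (avgD g ((n:ℤ) + 1) ⌊x * (2:ℝ) ^ ((n:ℤ) + 1)⌋) (g x)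
      (avgD g n ⌊x * (2:ℝ) ^ (n:ℤ)⌋)
    rw [abs_sub_comm (g x)] at h4
    linarith
  · simp only [Function.comp_def, deltaD_floor]
    refine key _ (3 * ∫ y, |g y|) (Eventually.of_forall fun n => ?_)
    have h1 := abs_avgD_le hg (-(n:ℤ)) ⌊x * (2:ℝ) ^ (-(n:ℤ))⌋
    have h2 := abs_avgD_le hg (-(n:ℤ) + 1) ⌊x * (2:ℝ) ^ (-(n:ℤ) + 1)⌋
    rw [zpow_add_one₀ two_ne_zero (-(n:ℤ))] at h2
    refine (abs_sub _ _).trans ?_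
    rw [zpow_add_one₀ two_ne_zero (-(n:ℤ))]
    linarith

theorem abs_deltaD_le_sqFn {g : ℝ → ℝ} (hg : Integrable g) {x : ℝ} (hx : DifferentiableAt ℝ g x)
    (n k : ℤ) : |deltaD g n k x| ≤ sqFn g x := by
  rw [sqFn, ← Real.sqrt_sq_eq_abs]
  exact Real.sqrt_le_sqrt
    ((summable_deltaD_sq hg hx).le_tsum (n, k) fun q _ => sq_nonneg _)

/-- The function `|x|^{-β}` restricted to `[0, 1]`, with value `1` at the origin. -/
def powerBump (β : ℝ) (x : ℝ) : ℝ :=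
  (if x = 0 then 1 else |x| ^ (-β)) * Set.indicator (Set.Icc (0:ℝ) 1) (fun _ => (1:ℝ)) x

theorem powerBump_of_mem {β x : ℝ} (hx : x ∈ Set.Ioc (0:ℝ) 1) : powerBump β x = x ^ (-β) := by
  rw [powerBump, if_neg hx.1.ne', Set.indicator_of_mem (Set.Ioc_subset_Icc_self hx), mul_one,
    abs_of_pos hx.1]

theorem integrable_powerBump {β : ℝ} (hβ : β < 1) : Integrable (powerBump β) := by
  have h : IntegrableOn (fun x : ℝ => x ^ (-β)) (Set.Ioc 0 1) :=
    (intervalIntegrable_iff_integrableOn_Ioc_of_le zero_le_one).1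
      (intervalIntegral.intervalIntegrable_rpow' (by linarith))
  have h' : IntegrableOn (powerBump β) (Set.Icc 0 1) := by
    rw [integrableOn_Icc_iff_integrableOn_Ioc]
    exact h.congr_fun (fun x hx => (powerBump_of_mem hx).symm) measurableSet_Ioc
  refine (integrableOn_iff_integrable_of_support_subset fun x hx => ?_).1 h'
  by_contra hn
  exact hx (by simp [powerBump, Set.indicator_of_notMem hn])

theorem differentiableAt_powerBump (β : ℝ) {x : ℝ} (hx : x ∈ Set.Ioo (0:ℝ) 1) :
    DifferentiableAt ℝ (powerBump β) x := by
  have h : DifferentiableAt ℝ (fun y : ℝ => y ^ (-β)) x :=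
    Real.differentiableAt_rpow_const_of_ne _ hx.1.ne'
  refine h.congr_of_eventuallyEq ?_
  filter_upwards [isOpen_Ioo.mem_nhds hx] with y hy
  exact powerBump_of_mem (Set.Ioo_subset_Ioc_self hy)

theorem setIntegral_powerBump {β a b : ℝ} (hβ : β < 1) (ha : 0 ≤ a) (hab : a ≤ b) (hb : b ≤ 1) :
    ∫ x in Set.Ico a b, powerBump β x = (b ^ (1 - β) - a ^ (1 - β)) / (1 - β) := by
  rw [integral_Ico_eq_integral_Ioc, setIntegral_congr_fun measurableSet_Ioc
    (fun x hx => powerBump_of_mem ⟨ha.trans_lt hx.1, hx.2.trans hb⟩),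
    ← intervalIntegral.integral_of_le hab, integral_rpow (Or.inl (by linarith)), neg_add_eq_sub]

/-- Pointwise lower bound for the square function, coming from the dyadic interval with left
endpoint `0` whose right child contains `x`. -/
theorem rpow_le_sqFn_powerBump {β x : ℝ} (hβ : β ∈ Set.Ioo (1/2 : ℝ) 1)
    (hx : x ∈ Set.Ioo (0:ℝ) 1) :
    1 / 4 / (1 - β) * x ^ (-β) ≤ sqFn (powerBump β) x := by
  obtain ⟨n, hn⟩ := exists_mem_Ico_zpow hx.1 one_lt_two
  have hε : 0 < 1 - β := by linarith [hβ.2]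
  set u : ℝ := 2 ^ n with hu
  have hu0 : 0 < u := by positivity
  have hn1 : n < 0 := by
    by_contra! h
    linarith [one_le_zpow₀ (one_le_two (α := ℝ)) h, hn.1, hx.2]
  have hsucc : (2:ℝ) ^ (n + 1) = 2 * u := by rw [zpow_add_one₀ two_ne_zero]; ring
  have h2u : 2 * u ≤ 1 := by
    rw [← hsucc]; exact zpow_le_one_of_nonpos₀ one_le_two (by omega)
  have hxu : u ≤ x ∧ x < 2 * u := by rw [← hsucc]; exact hn
  refine le_trans ?_ (abs_deltaD_le_sqFn (integrable_powerBump hβ.2)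
    (differentiableAt_powerBump β hx) (-(n + 1)) 0)
  have e1 : avgD (powerBump β) (-(n + 1)) 0 = (2 * u)⁻¹ * ((2 * u) ^ (1 - β) / (1 - β)) := by
    rw [avgD, avgI, neg_neg, hsucc, setIntegral_powerBump hβ.2 (by simp) (by simp; linarith)
      (by simpa using h2u)]
    simp [Real.zero_rpow hε.ne']
  have e2 : avgD (powerBump β) (-(n + 1) + 1) (2 * 0 + 1) =
      u⁻¹ * (((2 * u) ^ (1 - β) - u ^ (1 - β)) / (1 - β)) := by
    have : -(-(n + 1) + 1) = n := by ring
    rw [avgD, avgI, this, ← hu, setIntegral_powerBump hβ.2 (by simp; linarith)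
      (by push_cast; linarith) (by push_cast; linarith)]
    push_cast
    ring_nf
  have hd : deltaD (powerBump β) (-(n + 1)) 0 x =
      u⁻¹ * (((2 * u) ^ (1 - β) - u ^ (1 - β)) / (1 - β)) -
        (2 * u)⁻¹ * ((2 * u) ^ (1 - β) / (1 - β)) := by
    have m0 : x ∈ dyadicI (-(n + 1)) 0 := by
      rw [dyadicI, neg_neg, hsucc]; simp; exact ⟨hx.1.le, hxu.2⟩
    have m1 : x ∈ dyadicI (-(n + 1) + 1) (2 * 0 + 1) := by
      have : -(-(n + 1) + 1) = n := by ring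
      rw [dyadicI, this, ← hu]; push_cast; constructor <;> linarith
    have m2 : x ∉ dyadicI (-(n + 1) + 1) (2 * 0) := by
      rw [mem_dyadicI_iff] at m1 ⊢; omega
    rw [deltaD, Set.indicator_of_mem m0, Set.indicator_of_mem m1, Set.indicator_of_notMem m2, e1,
      e2, zero_add]
  have h2 : (2:ℝ) ^ (1 - β) ≤ 3 / 2 := by
    calc (2:ℝ) ^ (1 - β) ≤ 2 ^ (1 / 2 : ℝ) :=
          Real.rpow_le_rpow_of_exponent_le one_le_two (by linarith [hβ.1])
      _ = √2 := (Real.sqrt_eq_rpow 2).symm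
      _ ≤ 3 / 2 := Real.sqrt_le_iff.2 ⟨by norm_num, by norm_num⟩
  have hpow : u ^ (-β) = u⁻¹ * u ^ (1 - β) := by
    rw [← Real.rpow_neg_one, ← Real.rpow_add hu0]; congr 1; ring
  have hd' : deltaD (powerBump β) (-(n + 1)) 0 x =
      -((1 - 2 ^ (1 - β) / 2) / (1 - β) * u ^ (-β)) := by
    rw [hd, Real.mul_rpow zero_le_two hu0.le, hpow]
    field_simp
    ring
  rw [hd', abs_neg]
  refine le_trans ?_ (le_abs_self _)
  have hmono : x ^ (-β) ≤ u ^ (-β) :=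
    Real.rpow_le_rpow_of_nonpos hu0 hxu.1 (by linarith [hβ.1])
  have hx' : 0 ≤ x ^ (-β) := Real.rpow_nonneg hx.1.le _
  have hcoef : 1 / 4 / (1 - β) ≤ (1 - 2 ^ (1 - β) / 2) / (1 - β) := by
    gcongr
    linarith
  exact mul_le_mul hcoef hmono hx' ((by positivity : (0:ℝ) ≤ 1 / 4 / (1 - β)).trans hcoef)

theorem setLIntegral_rpow_neg {β K : ℝ} (hβ : β < 1) (hK : 0 ≤ K) :
    ∫⁻ x in Set.Ioo (0:ℝ) 1, ENNReal.ofReal (K * x ^ (-β)) = ENNReal.ofReal (K / (1 - β)) := by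
  have h : IntegrableOn (fun x : ℝ => K * x ^ (-β)) (Set.Ioo 0 1) :=
    (((intervalIntegrable_iff_integrableOn_Ioo_of_le zero_le_one).1
      (intervalIntegral.intervalIntegrable_rpow' (by linarith)))).const_mul K
  rw [← ofReal_integral_eq_lintegral_ofReal h]
  · rw [← integral_Ioc_eq_integral_Ioo, ← intervalIntegral.integral_of_le zero_le_one,
      intervalIntegral.integral_const_mul, integral_rpow (Or.inl (by linarith)), neg_add_eq_sub,
      Real.one_rpow, Real.zero_rpow (by linarith), sub_zero, mul_one_div]
  · filter_upwards [ae_restrict_mem measurableSet_Ioo] with x hx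
    exact mul_nonneg hK (Real.rpow_nonneg hx.1.le _)

/-- For `p ∈ (1,∞)`, `β ∈ (1/2,1)`, `σ(x) = |x|^{-β}`,
`w(x) = |x|^{β(p-1)}` (with `σ(0) = w(0) = 1`) and `f = 1_{[0,1]}`, one has
`‖S(σf)‖_{L^p(w)} ≥ c_p (1-β)^{-1-1/p}` where `c_p > 0` depends only on `p`
and `S` is the dyadic square function on `ℝ`. -/
theorem statement6 (p : ℝ) (hp : 1 < p) :
    ∃ c > (0:ℝ), ∀ β ∈ Set.Ioo (1/2 : ℝ) 1,
      ENNReal.ofReal (c * (1 - β) ^ (-1 - 1/p)) ≤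
        pNorm p
          (sqFn (fun x =>
            (if x = 0 then 1 else |x| ^ (-β)) *
              Set.indicator (Set.Icc (0:ℝ) 1) (fun _ => (1:ℝ)) x))
          (fun x => if x = 0 then 1 else |x| ^ (β * (p - 1))) := by
  refine ⟨1 / 4, by norm_num, fun β hβ => ?_⟩
  change _ ≤ pNorm p (sqFn (powerBump β)) _
  have hε : 0 < 1 - β := by linarith [hβ.2]
  have hp0 : 0 < p := by linarith
  set K : ℝ := 1 / 4 / (1 - β) with hK
  have hK0 : 0 < K := by positivity
  have hI : ENNReal.ofReal (K ^ p / (1 - β)) ≤ ∫⁻ x : ℝ, ENNReal.ofReal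
      (|sqFn (powerBump β) x| ^ p * (if x = 0 then 1 else |x| ^ (β * (p - 1)))) := by
    rw [← setLIntegral_rpow_neg hβ.2 (by positivity)]
    refine le_trans (setLIntegral_mono' measurableSet_Ioo fun x hx => ?_)
      (setLIntegral_le_lintegral (Set.Ioo 0 1) _)
    refine ENNReal.ofReal_le_ofReal ?_
    rw [if_neg hx.1.ne', abs_of_pos hx.1]
    have hle : K * x ^ (-β) ≤ |sqFn (powerBump β) x| :=
      (rpow_le_sqFn_powerBump hβ hx).trans (le_abs_self _)
    have hx' : 0 ≤ x ^ (-β) := Real.rpow_nonneg hx.1.le _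
    calc K ^ p * x ^ (-β) = (K * x ^ (-β)) ^ p * x ^ (β * (p - 1)) := by
          rw [Real.mul_rpow hK0.le hx', ← Real.rpow_mul hx.1.le, mul_assoc,
            ← Real.rpow_add hx.1]
          congr 2
          ring
      _ ≤ _ := mul_le_mul_of_nonneg_right (Real.rpow_le_rpow (by positivity) hle hp0.le)
          (Real.rpow_nonneg hx.1.le _)
  refine le_trans (le_of_eq ?_) (ENNReal.rpow_le_rpow hI (by positivity))
  rw [ENNReal.ofReal_rpow_of_nonneg (by positivity) (by positivity)]
  congr 1
  rw [Real.div_rpow (by positivity) hε.le, ← Real.rpow_mul hK0.le, mul_one_div_cancel hp0.ne',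
    Real.rpow_one, sub_eq_add_neg (-1 : ℝ), Real.rpow_add hε, Real.rpow_neg_one,
    Real.rpow_neg hε.le, hK]
  ring

end
end

section
/- Let p ∈ (2,∞), r ∈ (1/p, 1/2), and α = 2r − 1 ∈ (−1, 0). Define weights on [0,1) by σ(x) = x^{1/(p−1)} and w(x) = 1/(x (1 − log₂ x)^{1−α}) for x ∈ (0,1) (σ(0)=w(0)=1). Then [w,σ]_{A_p} < ∞, where the supremum defining [w,σ]_{A_p} is taken over all subintervals of [0,1). Moreover [σ]_{A_2} < ∞. -/
open MeasureTheory Set Filter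
open scoped ENNReal NNReal

noncomputable section

theorem avgI_eq_Ioo (g : ℝ → ℝ) (a b : ℝ) :
    avgI g a b = (b - a)⁻¹ * ∫ x in Set.Ioo a b, g x := by
  rw [avgI, integral_Ico_eq_integral_Ioo]

theorem avgI_nonneg {g : ℝ → ℝ} {a b : ℝ} (hab : a < b) (hg : ∀ x ∈ Set.Ioo a b, 0 ≤ g x) :
    0 ≤ avgI g a b := by
  rw [avgI_eq_Ioo]
  exact mul_nonneg (inv_nonneg.2 (sub_pos.2 hab).le)
    (setIntegral_nonneg measurableSet_Ioo hg)

theorem avgI_le_of_abs_le {g : ℝ → ℝ} {a b K : ℝ} (hab : a < b)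
    (hg : ∀ x ∈ Set.Ioo a b, |g x| ≤ K) : avgI g a b ≤ K := by
  have h := norm_setIntegral_le_of_norm_le_const (μ := volume) (s := Set.Ioo a b) (f := g)
    (by simp) hg
  rw [Real.volume_real_Ioo_of_le hab.le] at h
  have hpos := sub_pos.2 hab
  rw [avgI_eq_Ioo, inv_mul_le_iff₀ hpos, mul_comm]
  exact (le_abs_self _).trans h

/-- The average of a nonnegative function over `[a, b)` is controlled by its mass on `(0, b)` when
`a ≤ b / 2`, and by its size on `(b / 2, b)` otherwise. -/
theorem avgI_le_add {g : ℝ → ℝ} {a b K M : ℝ} (ha : 0 ≤ a) (hab : a < b)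
    (hg : ∀ x ∈ Set.Ioo 0 b, 0 ≤ g x) (hint : IntegrableOn g (Set.Ioo 0 b))
    (hK : ∀ x ∈ Set.Ioo (b / 2) b, g x ≤ K) (hM : ∫ x in Set.Ioo 0 b, g x ≤ b * M) :
    avgI g a b ≤ K + 2 * M := by
  have hb : 0 < b := ha.trans_lt hab
  have hK0 : 0 ≤ K :=
    (hg (3 / 4 * b) ⟨by linarith, by linarith⟩).trans (hK _ ⟨by linarith, by linarith⟩)
  have hM0 : 0 ≤ M :=
    nonneg_of_mul_nonneg_right ((setIntegral_nonneg measurableSet_Ioo hg).trans hM) hb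
  rcases le_or_gt a (b / 2) with h | h
  · have hmono : ∫ x in Set.Ioo a b, g x ≤ ∫ x in Set.Ioo 0 b, g x :=
      setIntegral_mono_set hint ((ae_restrict_iff' measurableSet_Ioo).2 (.of_forall hg))
        (Set.Ioo_subset_Ioo_left ha).eventuallyLE
    rw [avgI_eq_Ioo, inv_mul_le_iff₀ (sub_pos.2 hab)]
    nlinarith
  · have := avgI_le_of_abs_le (g := g) (K := K) hab fun x hx => by
      rw [abs_of_nonneg (hg x ⟨ha.trans_lt hx.1, hx.2⟩)]
      exact hK x ⟨h.trans hx.1, hx.2⟩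
    linarith

theorem apChar01_lt_top {p C : ℝ} {w σ : ℝ → ℝ}
    (h : ∀ a b : ℝ, 0 ≤ a → a < b → b ≤ 1 → avgI w a b * (avgI σ a b) ^ (p - 1) ≤ C) :
    apChar01 p w σ < ⊤ := by
  refine lt_of_le_of_lt ?_ (ENNReal.ofReal_lt_top (r := C))
  simp only [apChar01, iSup_le_iff]
  exact fun a b ha hab hb => ENNReal.ofReal_le_ofReal (h a b ha hab hb)

theorem one_le_one_sub_logb {x : ℝ} (hx : 0 < x) (hx1 : x ≤ 1) : 1 ≤ 1 - Real.logb 2 x := by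
  have := Real.logb_nonpos one_lt_two hx.le hx1
  linarith

theorem inv_mul_one_sub_logb_rpow_nonneg (s : ℝ) :
    ∀ x ∈ Set.Ioo (0 : ℝ) 1, 0 ≤ (x * (1 - Real.logb 2 x) ^ s)⁻¹ := fun _ hx =>
  inv_nonneg.2 (mul_nonneg hx.1.le
    (Real.rpow_nonneg (zero_le_one.trans (one_le_one_sub_logb hx.1 hx.2.le)) _))

theorem hasDerivAt_one_sub_logb_rpow {x : ℝ} (s : ℝ) (hx : 0 < x) (hx1 : x ≤ 1) :
    HasDerivAt (fun y => (1 - Real.logb 2 y) ^ (1 - s))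
      ((s - 1) / Real.log 2 * (x * (1 - Real.logb 2 x) ^ s)⁻¹) x := by
  have hpos : 0 < 1 - Real.logb 2 x := by linarith [one_le_one_sub_logb hx hx1]
  have h1 : HasDerivAt (fun y => 1 - Real.logb 2 y) (-(x⁻¹ / Real.log 2)) x :=
    ((Real.hasDerivAt_log hx.ne').div_const _).const_sub 1
  convert h1.rpow_const (p := 1 - s) (Or.inl hpos.ne') using 1
  rw [show 1 - s - 1 = -s by ring, Real.rpow_neg hpos.le, mul_inv]
  ring

theorem tendsto_one_sub_logb_rpow {s : ℝ} (hs : 1 < s) :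
    Tendsto (fun y => (1 - Real.logb 2 y) ^ (1 - s)) (nhdsWithin 0 (Set.Ioi 0)) (nhds 0) := by
  have h : Tendsto (fun y => 1 - Real.logb 2 y) (nhdsWithin 0 (Set.Ioi 0)) atTop := by
    simp only [sub_eq_add_neg]
    exact tendsto_atTop_add_const_left _ _ (tendsto_neg_atBot_atTop.comp
      (Real.tendsto_log_nhdsGT_zero.atBot_div_const (Real.log_pos one_lt_two)))
  have := (tendsto_rpow_neg_atTop (sub_pos.2 hs)).comp h
  simpa [Function.comp_def] using this

theorem integrableOn_inv_mul_one_sub_logb_rpow {s : ℝ} (hs : 1 < s) :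
    IntegrableOn (fun x => (x * (1 - Real.logb 2 x) ^ s)⁻¹) (Set.Ioo 0 1) := by
  have hc : 0 < (s - 1) / Real.log 2 := div_pos (sub_pos.2 hs) (Real.log_pos one_lt_two)
  have key : IntegrableOn
      (fun x => (s - 1) / Real.log 2 * (x * (1 - Real.logb 2 x) ^ s)⁻¹) (Set.Ioc 0 1) := by
    refine intervalIntegral.integrableOn_deriv_of_nonneg
      (g := Function.update (fun y => (1 - Real.logb 2 y) ^ (1 - s)) 0 0) ?_ ?_
      fun x hx => mul_nonneg hc.le (inv_mul_one_sub_logb_rpow_nonneg s x hx)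
    · rw [continuousOn_update_iff]
      constructor
      · rintro x ⟨⟨hx, hx1⟩, hx0⟩
        exact (hasDerivAt_one_sub_logb_rpow s (lt_of_le_of_ne hx (Ne.symm hx0))
          hx1).continuousAt.continuousWithinAt
      · exact fun _ => (tendsto_one_sub_logb_rpow hs).mono_left (nhdsWithin_mono _
          fun x hx => lt_of_le_of_ne hx.1.1 (Ne.symm hx.2))
    · intro x hx
      refine (hasDerivAt_one_sub_logb_rpow s hx.1 hx.2.le).congr_of_eventuallyEq ?_
      filter_upwards [eventually_ne_nhds hx.1.ne'] with y hy
      rw [Function.update_of_ne hy]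
  refine IntegrableOn.congr_fun ((key.mono_set Set.Ioo_subset_Ioc_self).const_mul
    ((s - 1) / Real.log 2)⁻¹) (fun x _ => ?_) measurableSet_Ioo
  exact inv_mul_cancel_left₀ hc.ne' _

theorem avgI_log_weight_le {s : ℝ} (hs : 1 < s) {a b : ℝ} (ha : 0 ≤ a) (hab : a < b)
    (hb1 : b ≤ 1) :
    avgI (fun x => if x = 0 then 1 else (x * (1 - Real.logb 2 x) ^ s)⁻¹) a b ≤
      (2 + 2 * ∫ x in Set.Ioo 0 1, (x * (1 - Real.logb 2 x) ^ s)⁻¹) / b := by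
  have hb : 0 < b := ha.trans_lt hab
  have hsub : Set.Ioo (0 : ℝ) b ⊆ Set.Ioo 0 1 := Set.Ioo_subset_Ioo_right hb1
  have heq : Set.EqOn (fun x : ℝ => if x = 0 then 1 else (x * (1 - Real.logb 2 x) ^ s)⁻¹)
      (fun x => (x * (1 - Real.logb 2 x) ^ s)⁻¹) (Set.Ioo 0 b) := fun x hx => if_neg hx.1.ne'
  have hint := integrableOn_inv_mul_one_sub_logb_rpow hs
  have hnn := inv_mul_one_sub_logb_rpow_nonneg s
  refine (avgI_le_add (K := 2 / b)
    (M := (∫ x in Set.Ioo 0 1, (x * (1 - Real.logb 2 x) ^ s)⁻¹) / b) ha hab ?_ ?_ ?_ ?_).trans_eq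
    (by ring)
  · exact fun x hx => (hnn x (hsub hx)).trans_eq (heq hx).symm
  · exact (hint.mono_set hsub).congr_fun heq.symm measurableSet_Ioo
  · intro x hx
    have hx0 : 0 < x := (half_pos hb).trans hx.1
    rw [if_neg hx0.ne', ← inv_div]
    refine inv_anti₀ (half_pos hb) (hx.1.le.trans (le_mul_of_one_le_right hx0.le ?_))
    exact Real.one_le_rpow (one_le_one_sub_logb hx0 (hx.2.le.trans hb1)) (by linarith)
  · rw [setIntegral_congr_fun measurableSet_Ioo heq, mul_div_cancel₀ _ hb.ne']
    exact setIntegral_mono_set hint ((ae_restrict_iff' measurableSet_Ioo).2 (.of_forall hnn))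
      hsub.eventuallyLE

theorem avgI_rpow_nonneg {t a b : ℝ} (ha : 0 ≤ a) (hab : a < b) :
    0 ≤ avgI (fun x => if x = 0 then 1 else x ^ t) a b :=
  avgI_nonneg hab fun x hx => by
    have hx0 := ha.trans_lt hx.1
    rw [if_neg hx0.ne']
    positivity

theorem avgI_rpow_le {t a b : ℝ} (ht : 0 ≤ t) (ha : 0 ≤ a) (hab : a < b) :
    avgI (fun x => if x = 0 then 1 else x ^ t) a b ≤ b ^ t :=
  avgI_le_of_abs_le hab fun x hx => by
    have hx0 := ha.trans_lt hx.1
    rw [if_neg hx0.ne', abs_of_nonneg (by positivity)]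
    exact Real.rpow_le_rpow hx0.le hx.2.le ht

theorem avgI_inv_rpow_le {t a b : ℝ} (ht : 0 ≤ t) (ht1 : t < 1) (ha : 0 ≤ a) (hab : a < b) :
    avgI (fun x => (if x = 0 then 1 else x ^ t)⁻¹) a b ≤
      (2 ^ t + 2 / (1 - t)) * (b ^ t)⁻¹ := by
  have hb : 0 < b := ha.trans_lt hab
  have heq : Set.EqOn (fun x : ℝ => (if x = 0 then 1 else x ^ t)⁻¹) (fun x => x ^ (-t))
      (Set.Ioo 0 b) := fun x hx => by
    simp only [if_neg hx.1.ne', Real.rpow_neg hx.1.le]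
  have hint : IntegrableOn (fun x : ℝ => x ^ (-t)) (Set.Ioo 0 b) :=
    (intervalIntegral.integrableOn_Ioo_rpow_iff hb).2 (by linarith)
  refine (avgI_le_add (K := 2 ^ t * (b ^ t)⁻¹) (M := (b ^ t)⁻¹ / (1 - t)) ha hab ?_ ?_ ?_
    ?_).trans_eq (by ring)
  · exact fun x hx => (Real.rpow_nonneg hx.1.le _).trans_eq (heq hx).symm
  · exact hint.congr_fun heq.symm measurableSet_Ioo
  · intro x hx
    have hx0 : 0 < x := (half_pos hb).trans hx.1
    rw [if_neg hx0.ne', ← div_eq_mul_inv, ← inv_div, ← Real.div_rpow hb.le zero_le_two]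
    exact inv_anti₀ (by positivity) (Real.rpow_le_rpow (half_pos hb).le hx.1.le ht)
  · rw [setIntegral_congr_fun measurableSet_Ioo heq, ← integral_Ioc_eq_integral_Ioo,
      ← intervalIntegral.integral_of_le hb.le, integral_rpow (Or.inl (by linarith)),
      Real.zero_rpow (by linarith), Real.rpow_add hb, Real.rpow_one, Real.rpow_neg hb.le,
      neg_add_eq_sub]
    exact le_of_eq (by ring)

/-- For `p ∈ (2,∞)`, `r ∈ (1/p, 1/2)`, `α = 2r - 1 ∈ (-1,0)`, and the
weights on `[0,1)` given by `σ(x) = x^{1/(p-1)}` and `w(x) = 1/(x (1 - log₂ x)^{1-α})`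
(with `σ(0) = w(0) = 1`), one has `[w,σ]_{A_p} < ∞` (supremum over subintervals of
`[0,1)`) and `[σ]_{A_2} = [σ, σ^{-1}]_{A_2} < ∞`. -/
theorem statement12 (p r : ℝ) (hp : 2 < p) (hr : r ∈ Set.Ioo (1/p) (1/2 : ℝ)) :
    apChar01 p
        (fun x => if x = 0 then 1 else (x * (1 - Real.logb 2 x) ^ (1 - (2*r - 1)))⁻¹)
        (fun x => if x = 0 then 1 else x ^ (1/(p - 1))) < ⊤ ∧
    apChar01 2 (fun x => if x = 0 then 1 else x ^ (1/(p - 1)))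
        (fun x => (if x = 0 then 1 else x ^ (1/(p - 1)))⁻¹) < ⊤ := by
  obtain ⟨-, hr2⟩ := hr
  have hp1 : 0 < p - 1 := by linarith
  have ht : 0 ≤ 1 / (p - 1) := by positivity
  have ht1 : 1 / (p - 1) < 1 := (div_lt_one hp1).2 (by linarith)
  constructor
  · refine apChar01_lt_top (C := 2 + 2 * ∫ x in Set.Ioo 0 1,
      (x * (1 - Real.logb 2 x) ^ (1 - (2 * r - 1)))⁻¹) fun a b ha hab hb1 => ?_
    have hb : 0 < b := ha.trans_lt hab
    have hσ0 := avgI_rpow_nonneg (t := 1 / (p - 1)) ha hab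
    have hσ := Real.rpow_le_rpow hσ0 (avgI_rpow_le ht ha hab) hp1.le
    rw [← Real.rpow_mul hb.le, one_div_mul_cancel hp1.ne', Real.rpow_one] at hσ
    refine (mul_le_mul_of_nonneg_right (avgI_log_weight_le (by linarith) ha hab hb1)
      (Real.rpow_nonneg hσ0 _)).trans ?_
    rw [div_mul_eq_mul_div, div_le_iff₀ hb]
    refine mul_le_mul_of_nonneg_left hσ (add_nonneg zero_le_two (mul_nonneg zero_le_two ?_))
    exact setIntegral_nonneg measurableSet_Ioo (inv_mul_one_sub_logb_rpow_nonneg _)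
  · refine apChar01_lt_top (C := 2 ^ (1 / (p - 1)) + 2 / (1 - 1 / (p - 1)))
      fun a b ha hab _ => ?_
    have hb : 0 < b := ha.trans_lt hab
    have hbt : 0 < b ^ (1 / (p - 1)) := by positivity
    rw [show (2 : ℝ) - 1 = 1 by norm_num, Real.rpow_one]
    have hσ0 := avgI_rpow_nonneg (t := 1 / (p - 1)) ha hab
    have hC : 0 < (2 : ℝ) ^ (1 / (p - 1)) + 2 / (1 - 1 / (p - 1)) :=
      add_pos (by positivity) (div_pos two_pos (sub_pos.2 ht1))
    calc _ ≤ avgI (fun x => if x = 0 then 1 else x ^ (1 / (p - 1))) a b *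
          ((2 ^ (1 / (p - 1)) + 2 / (1 - 1 / (p - 1))) * (b ^ (1 / (p - 1)))⁻¹) :=
          mul_le_mul_of_nonneg_left (avgI_inv_rpow_le ht ht1 ha hab) hσ0
      _ ≤ b ^ (1 / (p - 1)) *
          ((2 ^ (1 / (p - 1)) + 2 / (1 - 1 / (p - 1))) * (b ^ (1 / (p - 1)))⁻¹) :=
          mul_le_mul_of_nonneg_right (avgI_rpow_le ht ha hab) (by positivity)
      _ = _ := by field_simp

end
end

section
/- Let p ∈ (1,∞) and r ∈ (1/p, 1/2). Let f(x) = (−1)^{⌊−log₂ x⌋} x^{−1/(p−1)} (1 − log₂ x)^{−r} and σ(x) = x^{1/(p−1)} for x ∈ (0,1). Then ∫_{(0,1)} |f(x)|^p σ(x) dx = ∫_{(0,1)} x^{−1} (1 − log₂ x)^{−pr} dx = (log 2)/(pr − 1); in particular f ∈ L^p(σ). -/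
open MeasureTheory Set

lemma hasDerivAt_one_sub_logb_two {x : ℝ} (hx : x ≠ 0) :
    HasDerivAt (fun x => 1 - Real.logb 2 x) (-(x⁻¹ / Real.log 2)) x :=
  ((Real.hasDerivAt_log hx).div_const _).const_sub 1

lemma injOn_one_sub_logb_two : InjOn (fun x => 1 - Real.logb 2 x) (Ioo (0 : ℝ) 1) :=
  fun _ hx _ hy h => Real.logb_injOn_pos one_lt_two hx.1 hy.1 (sub_right_injective h)

lemma image_one_sub_logb_two : (fun x => 1 - Real.logb 2 x) '' Ioo (0 : ℝ) 1 = Ioi 1 := by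
  ext t
  simp only [mem_image, mem_Ioi]
  constructor
  · rintro ⟨x, hx, rfl⟩
    linarith [Real.logb_neg one_lt_two hx.1 hx.2]
  · intro ht
    refine ⟨2 ^ (1 - t), ⟨by positivity, ?_⟩, ?_⟩
    · exact Real.rpow_lt_one_of_one_lt_of_neg one_lt_two (by linarith)
    · rw [Real.logb_rpow two_pos (by norm_num)]
      ring

lemma abs_deriv_smul_one_sub_logb_two (a : ℝ) {x : ℝ} (hx : x ∈ Ioo (0 : ℝ) 1) :
    |-(x⁻¹ / Real.log 2)| • (1 - Real.logb 2 x) ^ a =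
      (Real.log 2)⁻¹ * (x⁻¹ * (1 - Real.logb 2 x) ^ a) := by
  have hlog : 0 < Real.log 2 := Real.log_pos one_lt_two
  have hx0 := hx.1
  rw [abs_neg, abs_of_pos (by positivity), smul_eq_mul]
  ring

lemma integrableOn_inv_mul_one_sub_logb_two_rpow {a : ℝ} (ha : a < -1) :
    IntegrableOn (fun x => x⁻¹ * (1 - Real.logb 2 x) ^ a) (Ioo (0 : ℝ) 1) := by
  have hlog : 0 < Real.log 2 := Real.log_pos one_lt_two
  have h := integrableOn_Ioi_rpow_of_lt ha one_pos
  rw [← image_one_sub_logb_two, integrableOn_image_iff_integrableOn_abs_deriv_smul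
    measurableSet_Ioo (fun x hx => (hasDerivAt_one_sub_logb_two hx.1.ne').hasDerivWithinAt)
    injOn_one_sub_logb_two, integrableOn_congr_fun
    (fun x hx => abs_deriv_smul_one_sub_logb_two a hx) measurableSet_Ioo] at h
  exact (integrable_const_mul_iff (isUnit_iff_ne_zero.2 (inv_ne_zero hlog.ne')) _).1 h

lemma integral_inv_mul_one_sub_logb_two_rpow {a : ℝ} (ha : a < -1) :
    ∫ x in Ioo (0 : ℝ) 1, x⁻¹ * (1 - Real.logb 2 x) ^ a = -Real.log 2 / (a + 1) := by
  have hlog : 0 < Real.log 2 := Real.log_pos one_lt_two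
  have h := integral_Ioi_rpow_of_lt ha one_pos
  rw [← image_one_sub_logb_two, integral_image_eq_integral_abs_deriv_smul
    measurableSet_Ioo (fun x hx => (hasDerivAt_one_sub_logb_two hx.1.ne').hasDerivWithinAt)
    injOn_one_sub_logb_two, setIntegral_congr_fun measurableSet_Ioo
    (fun x hx => abs_deriv_smul_one_sub_logb_two a hx), integral_const_mul, Real.one_rpow,
    inv_mul_eq_iff_eq_mul₀ hlog.ne'] at h
  rw [h]
  ring

lemma abs_rpow_mul_weight_eq {p r x : ℝ} (hp : 1 < p) (hx : x ∈ Ioo (0 : ℝ) 1) :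
    |(-1 : ℝ) ^ ⌊-Real.logb 2 x⌋ * x ^ (-(1 / (p - 1))) * (1 - Real.logb 2 x) ^ (-r)| ^ p *
      x ^ (1 / (p - 1)) = x⁻¹ * (1 - Real.logb 2 x) ^ (-(p * r)) := by
  have hx0 := hx.1
  have hL : 0 < 1 - Real.logb 2 x := by linarith [Real.logb_neg one_lt_two hx.1 hx.2]
  have hp1 : p - 1 ≠ 0 := by linarith
  rw [abs_mul, abs_mul, abs_zpow, abs_neg, abs_one, one_zpow, one_mul,
    abs_of_pos (by positivity), abs_of_pos (by positivity),
    Real.mul_rpow (by positivity) (by positivity), ← Real.rpow_mul hx0.le, ← Real.rpow_mul hL.le,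
    mul_right_comm, ← Real.rpow_add hx0, ← Real.rpow_neg_one x]
  congr 2
  · field_simp
    ring
  · ring

/-- For `p ∈ (1,∞)` and `r ∈ (1/p, 1/2)`, with
`f(x) = (-1)^{⌊-log₂ x⌋} x^{-1/(p-1)} (1 - log₂ x)^{-r}` and `σ(x) = x^{1/(p-1)}` on
`(0,1)`, one has `∫_{(0,1)} |f|^p σ = ∫_{(0,1)} x^{-1} (1 - log₂ x)^{-pr} dx
= (log 2)/(pr - 1)`; in particular `f ∈ L^p(σ)`. -/
theorem statement13 (p r : ℝ) (hp : 1 < p) (hr : r ∈ Set.Ioo (1/p) (1/2 : ℝ)) :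
    (∫ x in Set.Ioo (0:ℝ) 1,
        |(-1:ℝ) ^ ⌊-Real.logb 2 x⌋ * x ^ (-(1/(p - 1))) * (1 - Real.logb 2 x) ^ (-r)| ^ p *
          x ^ (1/(p - 1))) = Real.log 2 / (p * r - 1) ∧
    (∫ x in Set.Ioo (0:ℝ) 1, x⁻¹ * (1 - Real.logb 2 x) ^ (-(p * r))) =
      Real.log 2 / (p * r - 1) ∧
    IntegrableOn
      (fun x =>
        |(-1:ℝ) ^ ⌊-Real.logb 2 x⌋ * x ^ (-(1/(p - 1))) * (1 - Real.logb 2 x) ^ (-r)| ^ p *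
          x ^ (1/(p - 1)))
      (Set.Ioo (0:ℝ) 1) := by
  have hpr : -(p * r) < -1 := by
    have := (div_lt_iff₀' (by linarith)).1 hr.1
    linarith
  have hval : ∫ x in Ioo (0 : ℝ) 1, x⁻¹ * (1 - Real.logb 2 x) ^ (-(p * r)) =
      Real.log 2 / (p * r - 1) := by
    rw [integral_inv_mul_one_sub_logb_two_rpow hpr, ← neg_div_neg_eq]
    ring_nf
  refine ⟨?_, hval, ?_⟩
  · rw [setIntegral_congr_fun measurableSet_Ioo fun x hx => abs_rpow_mul_weight_eq hp hx, hval]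
  · exact (integrableOn_congr_fun (fun x hx => abs_rpow_mul_weight_eq hp hx) measurableSet_Ioo).2
      (integrableOn_inv_mul_one_sub_logb_two_rpow hpr)
end

section
/- Let r ∈ (0, 1/2) and let g(x) = (−1)^{⌊−log₂ x⌋} (1 − log₂ x)^{−r} for x ∈ (0,1) (g(0) arbitrary). Then for every integer k ≥ 0 and every x ∈ [0, 2^{−(k+1)}), one has |Δ_{I_k} g(x)| ≥ 1/(4 (k+2)^r), where I_k = [0, 2^{−k}) and Δ_{I_k} g = ⟨g⟩_{I_{k+1}} 1_{I_{k+1}} + ⟨g⟩_{I_k \ I_{k+1}} 1_{I_k \ I_{k+1}} − ⟨g⟩_{I_k} 1_{I_k} is the dyadic martingale difference, with ⟨g⟩_J = (1/|J|)∫_J g. -/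
open MeasureTheory Set Filter
open scoped ENNReal NNReal

noncomputable section

/-- The function `(-1)^{⌊-log₂ x⌋} (1 - log₂ x)^{-r}`. -/
def oscLog (r x : ℝ) : ℝ := (-1:ℝ) ^ ⌊-Real.logb 2 x⌋ * (1 - Real.logb 2 x) ^ (-r)

lemma measurable_oscLog (r : ℝ) : Measurable (oscLog r) := by
  have hlog : Measurable (fun x : ℝ => Real.logb 2 x) := by
    unfold Real.logb
    fun_prop
  have hfloor : Measurable (fun x : ℝ => ⌊-Real.logb 2 x⌋) := Int.measurable_floor.comp hlog.neg
  have hsign : Measurable (fun n : ℤ => (-1:ℝ) ^ n) := measurable_from_top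
  exact (hsign.comp hfloor).mul ((measurable_const.sub hlog).pow_const (-r))

lemma natCast_lt_neg_logb {n : ℕ} {x : ℝ} (hx : 0 < x) (hxn : x < (1/2 : ℝ) ^ n) :
    (n : ℝ) < -Real.logb 2 x := by
  have h : Real.logb 2 x < Real.logb 2 ((1/2 : ℝ) ^ n) :=
    Real.logb_lt_logb (by norm_num) hx hxn
  rw [Real.logb_pow, one_div, Real.logb_inv, Real.logb_self_eq_one (by norm_num)] at h
  linarith

lemma neg_logb_lt_natCast {n : ℕ} {x : ℝ} (hxn : (1/2 : ℝ) ^ n < x) :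
    -Real.logb 2 x < n := by
  have h : Real.logb 2 ((1/2 : ℝ) ^ n) < Real.logb 2 x :=
    Real.logb_lt_logb (by norm_num) (by positivity) hxn
  rw [Real.logb_pow, one_div, Real.logb_inv, Real.logb_self_eq_one (by norm_num)] at h
  linarith

lemma abs_oscLog_le {r : ℝ} (hr : 0 ≤ r) {n : ℕ} {x : ℝ} (hx : 0 < x)
    (hxn : x < (1/2 : ℝ) ^ n) : |oscLog r x| ≤ ((n : ℝ) + 1) ^ (-r) := by
  have h := natCast_lt_neg_logb hx hxn
  have hn : (0:ℝ) ≤ n := n.cast_nonneg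
  rw [oscLog, abs_mul, abs_zpow, abs_neg, abs_one, one_zpow, one_mul,
    abs_of_nonneg (Real.rpow_nonneg (by linarith) _)]
  exact Real.rpow_le_rpow_of_nonpos (by linarith) (by linarith) (by linarith)

lemma le_neg_one_pow_mul_oscLog {r : ℝ} (hr : 0 ≤ r) {n : ℕ} {x : ℝ}
    (hx : (1/2 : ℝ) ^ (n + 1) < x) (hxn : x < (1/2 : ℝ) ^ n) :
    ((n : ℝ) + 2) ^ (-r) ≤ (-1) ^ n * oscLog r x := by
  have h := natCast_lt_neg_logb (lt_trans (by positivity) hx) hxn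
  have h' := neg_logb_lt_natCast hx
  have hn : (0:ℝ) ≤ n := n.cast_nonneg
  push_cast at h'
  have hfloor : ⌊-Real.logb 2 x⌋ = (n : ℤ) := by
    rw [Int.floor_eq_iff]
    push_cast
    exact ⟨h.le, h'⟩
  rw [oscLog, hfloor, zpow_natCast, ← mul_assoc, ← mul_pow]
  norm_num
  exact Real.rpow_le_rpow_of_nonpos (by linarith) (by linarith) (by linarith)

lemma integrableOn_oscLog {r : ℝ} (hr : 0 ≤ r) : IntegrableOn (oscLog r) (Ioo 0 1) := by
  refine IntegrableOn.of_bound (by simp) (measurable_oscLog r).aestronglyMeasurable 1 ?_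
  refine (ae_restrict_iff' measurableSet_Ioo).2 (ae_of_all _ fun x hx => ?_)
  simpa using abs_oscLog_le hr (n := 0) hx.1 (by simpa using hx.2)

lemma Ioo_half_pow_subset {a : ℝ} (ha : 0 ≤ a) (n : ℕ) :
    Ioo a ((1/2 : ℝ) ^ n) ⊆ Ioo 0 1 := fun _ hx =>
  ⟨ha.trans_lt hx.1, hx.2.trans_le (pow_le_one₀ (by norm_num) (by norm_num))⟩

lemma abs_setIntegral_oscLog_le {r : ℝ} (hr : 0 ≤ r) (n : ℕ) :
    |∫ x in Ioo 0 ((1/2 : ℝ) ^ n), oscLog r x| ≤ ((n : ℝ) + 1) ^ (-r) * (1/2) ^ n := by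
  have h := norm_setIntegral_le_of_norm_le_const (μ := volume) (f := oscLog r)
    (s := Ioo 0 ((1/2 : ℝ) ^ n)) (C := ((n : ℝ) + 1) ^ (-r)) measure_Ioo_lt_top
    (fun x hx => abs_oscLog_le hr hx.1 hx.2)
  rwa [Real.norm_eq_abs, Real.volume_real_Ioo_of_le (by positivity), sub_zero] at h

lemma le_neg_one_pow_mul_setIntegral_oscLog {r : ℝ} (hr : 0 ≤ r) (n : ℕ) :
    ((n : ℝ) + 2) ^ (-r) * (1/2) ^ (n + 1) ≤
      (-1) ^ n * ∫ x in Ioo ((1/2 : ℝ) ^ (n + 1)) ((1/2 : ℝ) ^ n), oscLog r x := by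
  have hle : (1/2 : ℝ) ^ (n + 1) ≤ (1/2) ^ n :=
    pow_le_pow_of_le_one (by norm_num) (by norm_num) n.le_succ
  have hint : IntegrableOn (fun x => (-1) ^ n * oscLog r x)
      (Ioo ((1/2 : ℝ) ^ (n + 1)) ((1/2 : ℝ) ^ n)) :=
    ((integrableOn_oscLog hr).mono_set (Ioo_half_pow_subset (by positivity) n)).const_mul _
  rw [← integral_const_mul]
  have h := setIntegral_mono_on (integrableOn_const (C := ((n : ℝ) + 2) ^ (-r)) (by simp))
    hint measurableSet_Ioo (fun x hx => le_neg_one_pow_mul_oscLog hr hx.1 hx.2)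
  rw [setIntegral_const, Real.volume_real_Ioo_of_le hle, smul_eq_mul] at h
  refine le_trans (le_of_eq ?_) h
  ring

lemma setIntegral_oscLog_eq_add {r : ℝ} (hr : 0 ≤ r) (n : ℕ) :
    ∫ x in Ioo 0 ((1/2 : ℝ) ^ n), oscLog r x =
      (∫ x in Ioo 0 ((1/2 : ℝ) ^ (n + 1)), oscLog r x) +
        ∫ x in Ioo ((1/2 : ℝ) ^ (n + 1)) ((1/2 : ℝ) ^ n), oscLog r x := by
  have hle : (1/2 : ℝ) ^ (n + 1) ≤ (1/2) ^ n :=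
    pow_le_pow_of_le_one (by norm_num) (by norm_num) n.le_succ
  have hpos : (0 : ℝ) ≤ (1/2) ^ (n + 1) := by positivity
  have hint (a : ℝ) (ha : 0 ≤ a) (m : ℕ) (ham : a ≤ (1/2 : ℝ) ^ m) :
      IntervalIntegrable (oscLog r) volume a ((1/2 : ℝ) ^ m) :=
    (intervalIntegrable_iff_integrableOn_Ioo_of_le ham).2
      ((integrableOn_oscLog hr).mono_set (Ioo_half_pow_subset ha m))
  simp only [← integral_Ioc_eq_integral_Ioo]
  rw [← intervalIntegral.integral_of_le hpos, ← intervalIntegral.integral_of_le hle,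
    ← intervalIntegral.integral_of_le (hpos.trans hle)]
  exact (intervalIntegral.integral_add_adjacent_intervals
    (hint 0 le_rfl (n + 1) hpos) (hint _ hpos n hle)).symm

/-- The mean over `[0, 2^{-n})` has the sign of the first piece `[2^{-(n+1)}, 2^{-n})`. -/
lemma neg_one_pow_mul_setIntegral_oscLog_nonneg {r : ℝ} (hr : 0 ≤ r) (n : ℕ) :
    0 ≤ (-1) ^ n * ∫ x in Ioo 0 ((1/2 : ℝ) ^ n), oscLog r x := by
  have hpiece := le_neg_one_pow_mul_setIntegral_oscLog hr n
  have htail := abs_setIntegral_oscLog_le hr (n + 1)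
  rw [setIntegral_oscLog_eq_add hr n, mul_add]
  have habs : |(-1) ^ n * ∫ x in Ioo 0 ((1/2 : ℝ) ^ (n + 1)), oscLog r x| =
      |∫ x in Ioo 0 ((1/2 : ℝ) ^ (n + 1)), oscLog r x| := by simp [abs_mul]
  have hneg := neg_abs_le ((-1) ^ n * ∫ x in Ioo 0 ((1/2 : ℝ) ^ (n + 1)), oscLog r x)
  have hcast : ((n + 1 : ℕ) : ℝ) + 1 = n + 2 := by push_cast; ring
  rw [hcast] at htail
  linarith

/-- On the left child of `[0, 2^{-k})` the martingale difference is half the difference of the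
means over the two children. -/
lemma deltaD_zero_eq (g : ℝ → ℝ) (k : ℕ) {x : ℝ}
    (hx : x ∈ Ico (0:ℝ) ((2:ℝ) ^ (-((k:ℤ) + 1)))) :
    deltaD g k 0 x = 2 ^ (k + 1) * (∫ y in Ioo 0 ((1/2 : ℝ) ^ (k + 1)), g y) -
      2 ^ k * ∫ y in Ioo 0 ((1/2 : ℝ) ^ k), g y := by
  have hpow (n : ℕ) : (2:ℝ) ^ (-(n:ℤ)) = (1/2) ^ n := by
    rw [zpow_neg, zpow_natCast, one_div, inv_pow]
  have hpow' : (2:ℝ) ^ (-((k:ℤ) + 1)) = (1/2) ^ (k + 1) := by exact_mod_cast hpow (k + 1)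
  have hle : (1/2 : ℝ) ^ (k + 1) ≤ (1/2) ^ k :=
    pow_le_pow_of_le_one (by norm_num) (by norm_num) k.le_succ
  rw [hpow'] at hx
  have hleft : x ∈ dyadicI (k + 1) (2 * 0) := by
    simp only [dyadicI, hpow']
    simpa using hx
  have hright : x ∉ dyadicI (k + 1) (2 * 0 + 1) := by
    simp only [dyadicI, hpow']
    intro h
    have := h.1
    norm_num at this hx
    linarith [hx.2]
  have hparent : x ∈ dyadicI k 0 := by
    simp only [dyadicI, hpow]
    simpa using ⟨hx.1, by simpa using hx.2.trans_le hle⟩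
  rw [deltaD, indicator_of_mem hleft, indicator_of_notMem hright, indicator_of_mem hparent]
  simp only [avgD, avgI, hpow, hpow', integral_Ico_eq_integral_Ioo]
  simp

/-- Let `r ∈ (0,1/2)` and `g(x) = (-1)^{⌊-log₂ x⌋} (1 - log₂ x)^{-r}`
on `(0,1)` (values elsewhere irrelevant/arbitrary). Then for every `k ≥ 0` and every
`x ∈ [0, 2^{-(k+1)})` one has `|Δ_{I_k} g (x)| ≥ 1/(4 (k+2)^r)`, where
`I_k = [0, 2^{-k})` and `Δ_{I_k}` is the dyadic martingale difference. -/
theorem statement14 (r : ℝ) (hr : r ∈ Set.Ioo (0:ℝ) (1/2 : ℝ)) (g : ℝ → ℝ)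
    (hg : ∀ x ∈ Set.Ioo (0:ℝ) 1,
      g x = (-1:ℝ) ^ ⌊-Real.logb 2 x⌋ * (1 - Real.logb 2 x) ^ (-r)) :
    ∀ k : ℕ, ∀ x ∈ Set.Ico (0:ℝ) ((2:ℝ) ^ (-((k:ℤ) + 1))),
      1 / (4 * ((k:ℝ) + 2) ^ r) ≤ |deltaD g (k:ℤ) 0 x| := by
  intro k x hx
  have hr0 : 0 ≤ r := hr.1.le
  have hgint (n : ℕ) : ∫ y in Ioo 0 ((1/2 : ℝ) ^ n), g y =
      ∫ y in Ioo 0 ((1/2 : ℝ) ^ n), oscLog r y :=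
    setIntegral_congr_fun measurableSet_Ioo fun y hy => hg y (Ioo_half_pow_subset le_rfl n hy)
  rw [deltaD_zero_eq g k hx, hgint, hgint, setIntegral_oscLog_eq_add hr0 k]
  have hchild := neg_one_pow_mul_setIntegral_oscLog_nonneg hr0 (k + 1)
  have hpiece := le_neg_one_pow_mul_setIntegral_oscLog hr0 k
  set J := ∫ y in Ioo 0 ((1/2 : ℝ) ^ (k + 1)), oscLog r y
  set P := ∫ y in Ioo ((1/2 : ℝ) ^ (k + 1)) ((1/2 : ℝ) ^ k), oscLog r y
  have hdiff : (2:ℝ) ^ (k + 1) * J - 2 ^ k * (J + P) = 2 ^ k * (J - P) := by ring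
  have hsign : |(2:ℝ) ^ k * (J - P)| = |2 ^ k * ((-1) ^ (k + 1) * J + (-1) ^ k * P)| := by
    have : (2:ℝ) ^ k * ((-1) ^ (k + 1) * J + (-1) ^ k * P) =
        (-1) ^ (k + 1) * (2 ^ k * (J - P)) := by ring
    rw [this, abs_mul ((-1) ^ (k + 1)), abs_neg_one_pow, one_mul]
  rw [hdiff, hsign]
  refine le_trans ?_ (le_abs_self _)
  have hhalf : (2:ℝ) ^ k * (((k:ℝ) + 2) ^ (-r) * (1/2) ^ (k + 1)) = ((k:ℝ) + 2) ^ (-r) / 2 := by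
    have : (2:ℝ) ^ k * (1/2) ^ k = 1 := by rw [← mul_pow]; norm_num
    linear_combination ((k:ℝ) + 2) ^ (-r) / 2 * this
  have hbound : 1 / (4 * ((k:ℝ) + 2) ^ r) ≤ ((k:ℝ) + 2) ^ (-r) / 2 := by
    have hk : (0:ℝ) < (k:ℝ) + 2 := by positivity
    have hinv := Real.rpow_pos_of_pos hk (-r)
    rw [one_div, mul_inv, ← Real.rpow_neg hk.le]
    linarith
  rw [← hhalf] at hbound
  refine hbound.trans (mul_le_mul_of_nonneg_left ?_ (by positivity))
  linarith
end
end

section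
/- Let r ∈ (0,1). For every integer k ≥ 0, | ∫_{(0, 2^{−(k+1)})} (−1)^{⌊−log₂ x⌋} (1 − log₂ x)^{−r} dx | ≤ 1/(2^{k+2} (k+2)^r). Moreover, for every integer l ≥ 0, 1/(2^{l+1}(l+2)^r) ≤ ∫_{(2^{−(l+1)}, 2^{−l})} (1 − log₂ x)^{−r} dx ≤ 1/(2^{l+1}(l+1)^r). -/
open MeasureTheory Set Filter Topology

/-- If `G` tends to zero and `G m + G (m + 1)` is antitone in `m`, then `G` is nonnegative. -/
lemma nonneg_of_add_succ_antitone {G a : ℕ → ℝ} (ha : Antitone a)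
    (hG : ∀ m, G m + G (m + 1) = a m) (hlim : Tendsto G atTop (𝓝 0)) (m : ℕ) : 0 ≤ G m := by
  have hanti : Antitone fun n => G (m + 2 * n) := by
    refine antitone_nat_of_succ_le fun n => ?_
    have h₁ := hG (m + 2 * n)
    have h₂ := hG (m + 2 * n + 1)
    have h₃ := ha (Nat.le_succ (m + 2 * n))
    simp only [Nat.succ_eq_add_one] at h₃
    have h₄ : m + 2 * (n + 1) = m + 2 * n + 1 + 1 := by ring
    rw [h₄]
    linarith
  have hsub : Tendsto (fun n => m + 2 * n) atTop atTop :=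
    tendsto_atTop_mono (fun n => show n ≤ m + 2 * n by omega) tendsto_id
  simpa using hanti.le_of_tendsto (hlim.comp hsub) 0

lemma neg_logb_mem_Ioo {l : ℕ} {x : ℝ}
    (hx : x ∈ Ioo ((2:ℝ) ^ (-((l:ℤ) + 1))) ((2:ℝ) ^ (-(l:ℤ)))) :
    -Real.logb 2 x ∈ Ioo (l:ℝ) (l + 1) := by
  have hpos : 0 < x := lt_trans (by positivity) hx.1
  have h₁ := Real.logb_lt_logb one_lt_two (by positivity) hx.1
  have h₂ := Real.logb_lt_logb one_lt_two hpos hx.2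
  rw [← Real.rpow_intCast, Real.logb_rpow (by norm_num) (by norm_num)] at h₁ h₂
  push_cast at h₁ h₂
  constructor <;> linarith

lemma one_sub_logb_rpow_mem_Icc {r : ℝ} (hr : 0 ≤ r) {x : ℝ} (hx : x ∈ Ioo (0:ℝ) 1) :
    (1 - Real.logb 2 x) ^ (-r) ∈ Icc (0:ℝ) 1 := by
  have h : Real.logb 2 x < 0 := Real.logb_neg one_lt_two hx.1 hx.2
  exact ⟨Real.rpow_nonneg (by linarith) _,
    Real.rpow_le_one_of_one_le_of_nonpos (by linarith) (by linarith)⟩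

lemma measurable_one_sub_logb_rpow (r : ℝ) :
    Measurable fun x : ℝ => (1 - Real.logb 2 x) ^ (-r) := by
  unfold Real.logb
  fun_prop

lemma integrableOn_one_sub_logb_rpow {r : ℝ} (hr : 0 ≤ r) :
    IntegrableOn (fun x : ℝ => (1 - Real.logb 2 x) ^ (-r)) (Ioo 0 1) := by
  refine Measure.integrableOn_of_bounded (M := 1) (by simp)
    (measurable_one_sub_logb_rpow r).aestronglyMeasurable ?_
  filter_upwards [ae_restrict_mem measurableSet_Ioo] with x hx
  have h := one_sub_logb_rpow_mem_Icc hr hx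
  rw [Real.norm_of_nonneg h.1]
  exact h.2

lemma norm_sign_mul_one_sub_logb_rpow_le {r : ℝ} (hr : 0 ≤ r) {x : ℝ} (hx : x ∈ Ioo (0:ℝ) 1) :
    ‖(-1:ℝ) ^ ⌊-Real.logb 2 x⌋ * (1 - Real.logb 2 x) ^ (-r)‖ ≤ 1 := by
  have h := one_sub_logb_rpow_mem_Icc hr hx
  rw [norm_mul, norm_zpow, norm_neg, norm_one, one_zpow, one_mul, Real.norm_of_nonneg h.1]
  exact h.2

lemma integrableOn_sign_mul_one_sub_logb_rpow {r : ℝ} (hr : 0 ≤ r) :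
    IntegrableOn (fun x : ℝ => (-1:ℝ) ^ ⌊-Real.logb 2 x⌋ * (1 - Real.logb 2 x) ^ (-r))
      (Ioo 0 1) := by
  have hsign : Measurable fun x : ℝ => (-1:ℝ) ^ ⌊-Real.logb 2 x⌋ := by
    have hlog : Measurable fun x : ℝ => -Real.logb 2 x := by
      unfold Real.logb
      fun_prop
    exact (measurable_from_top (f := fun n : ℤ => (-1:ℝ) ^ n)).comp hlog.floor
  refine Measure.integrableOn_of_bounded (M := 1) (by simp)
    (hsign.mul (measurable_one_sub_logb_rpow r)).aestronglyMeasurable ?_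
  filter_upwards [ae_restrict_mem measurableSet_Ioo] with x hx
  exact norm_sign_mul_one_sub_logb_rpow_le hr hx

lemma Ioo_zero_two_zpow_neg_subset (m : ℕ) : Ioo (0:ℝ) (2 ^ (-(m:ℤ))) ⊆ Ioo 0 1 :=
  Ioo_subset_Ioo_right (zpow_le_one_of_nonpos₀ one_le_two (by simp))

lemma dyadic_Ioo_subset (l : ℕ) :
    Ioo ((2:ℝ) ^ (-((l:ℤ) + 1))) ((2:ℝ) ^ (-(l:ℤ))) ⊆ Ioo 0 1 :=
  (Ioo_subset_Ioo_left (by positivity)).trans (Ioo_zero_two_zpow_neg_subset l)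

lemma volume_real_dyadic_Ioo (l : ℕ) :
    volume.real (Ioo ((2:ℝ) ^ (-((l:ℤ) + 1))) ((2:ℝ) ^ (-(l:ℤ)))) = 1 / 2 ^ (l + 1) := by
  have h : (2:ℝ) ^ (-(l:ℤ)) = 2 * 2 ^ (-((l:ℤ) + 1)) := by
    rw [← zpow_one_add₀ two_ne_zero]
    congr 1
    ring
  have hnat : (2:ℝ) ^ (-((l:ℤ) + 1)) = 1 / 2 ^ (l + 1) := by
    rw [zpow_neg, one_div]
    norm_cast
  have hpos : (0:ℝ) < 2 ^ (-((l:ℤ) + 1)) := by positivity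
  rw [Real.volume_real_Ioo_of_le (by linarith), h, ← hnat]
  ring

lemma integral_dyadic_one_sub_logb_rpow_bounds {r : ℝ} (hr : 0 ≤ r) (l : ℕ) :
    1 / (2 ^ (l + 1) * ((l:ℝ) + 2) ^ r) ≤
        (∫ x in Ioo ((2:ℝ) ^ (-((l:ℤ) + 1))) ((2:ℝ) ^ (-(l:ℤ))),
          (1 - Real.logb 2 x) ^ (-r)) ∧
      (∫ x in Ioo ((2:ℝ) ^ (-((l:ℤ) + 1))) ((2:ℝ) ^ (-(l:ℤ))),
          (1 - Real.logb 2 x) ^ (-r)) ≤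
        1 / (2 ^ (l + 1) * ((l:ℝ) + 1) ^ r) := by
  have hl : (0:ℝ) ≤ l := l.cast_nonneg
  have hint := (integrableOn_one_sub_logb_rpow hr).mono_set (dyadic_Ioo_subset l)
  have hconst (c : ℝ) (hc : 0 ≤ c) : 1 / (2 ^ (l + 1) * c ^ r) =
      ∫ _ in Ioo ((2:ℝ) ^ (-((l:ℤ) + 1))) ((2:ℝ) ^ (-(l:ℤ))), c ^ (-r) := by
    rw [setIntegral_const, volume_real_dyadic_Ioo, Real.rpow_neg hc, smul_eq_mul,
      one_div_mul_eq_div, div_eq_mul_inv, div_eq_mul_inv, mul_inv]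
    ring
  rw [hconst _ (by linarith), hconst _ (by linarith)]
  constructor
  · refine setIntegral_mono_on (integrableOn_const (by simp)) hint measurableSet_Ioo fun x hx => ?_
    have h := neg_logb_mem_Ioo hx
    exact Real.rpow_le_rpow_of_nonpos (by linarith [h.1]) (by linarith [h.2]) (by linarith)
  · refine setIntegral_mono_on hint (integrableOn_const (by simp)) measurableSet_Ioo fun x hx => ?_
    have h := neg_logb_mem_Ioo hx
    exact Real.rpow_le_rpow_of_nonpos (by linarith) (by linarith [h.1]) (by linarith)

lemma antitone_integral_dyadic_one_sub_logb_rpow {r : ℝ} (hr : 0 ≤ r) :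
    Antitone fun l : ℕ => ∫ x in Ioo ((2:ℝ) ^ (-((l:ℤ) + 1))) ((2:ℝ) ^ (-(l:ℤ))),
      (1 - Real.logb 2 x) ^ (-r) := by
  refine antitone_nat_of_succ_le fun l => ?_
  refine (integral_dyadic_one_sub_logb_rpow_bounds hr (l + 1)).2.trans
    (le_trans ?_ (integral_dyadic_one_sub_logb_rpow_bounds hr l).1)
  have h : ((l + 1 : ℕ):ℝ) + 1 = l + 2 := by
    push_cast
    ring
  rw [h]
  gcongr
  · norm_num
  · omega

lemma integral_sign_mul_one_sub_logb_rpow_eq_add {r : ℝ} (hr : 0 ≤ r) (m : ℕ) :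
    ∫ x in Ioo (0:ℝ) (2 ^ (-(m:ℤ))),
        (-1:ℝ) ^ ⌊-Real.logb 2 x⌋ * (1 - Real.logb 2 x) ^ (-r) =
      (∫ x in Ioo (0:ℝ) (2 ^ (-((m:ℤ) + 1))),
        (-1:ℝ) ^ ⌊-Real.logb 2 x⌋ * (1 - Real.logb 2 x) ^ (-r)) +
      (-1) ^ m * ∫ x in Ioo ((2:ℝ) ^ (-((m:ℤ) + 1))) (2 ^ (-(m:ℤ))),
        (1 - Real.logb 2 x) ^ (-r) := by
  have hlt : (2:ℝ) ^ (-((m:ℤ) + 1)) < 2 ^ (-(m:ℤ)) :=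
    zpow_lt_zpow_right₀ one_lt_two (by omega)
  have hunion := Ioc_union_Ioo_eq_Ioo (a := (0:ℝ)) (b := 2 ^ (-((m:ℤ) + 1)))
    (c := 2 ^ (-(m:ℤ))) (by positivity) hlt
  have hint := (integrableOn_sign_mul_one_sub_logb_rpow hr).mono_set
    (Ioo_zero_two_zpow_neg_subset m)
  rw [← hunion] at hint ⊢
  rw [setIntegral_union (disjoint_left.2 fun x hx hx' => hx.2.not_gt hx'.1) measurableSet_Ioo
    hint.left_of_union hint.right_of_union, integral_Ioc_eq_integral_Ioo, ← integral_const_mul]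
  congr 1
  refine setIntegral_congr_fun measurableSet_Ioo fun x hx => ?_
  have h := neg_logb_mem_Ioo hx
  have hfloor : ⌊-Real.logb 2 x⌋ = (m:ℤ) :=
    Int.floor_eq_iff.2 ⟨by exact_mod_cast h.1.le, by exact_mod_cast h.2⟩
  simp only [hfloor, zpow_natCast]

lemma tendsto_integral_sign_mul_one_sub_logb_rpow {r : ℝ} (hr : 0 ≤ r) :
    Tendsto (fun m : ℕ => (-1) ^ m * ∫ x in Ioo (0:ℝ) (2 ^ (-(m:ℤ))),
      (-1:ℝ) ^ ⌊-Real.logb 2 x⌋ * (1 - Real.logb 2 x) ^ (-r)) atTop (𝓝 0) := by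
  refine squeeze_zero_norm (a := fun m : ℕ => ((1:ℝ) / 2) ^ m) (fun m => ?_)
    (tendsto_pow_atTop_nhds_zero_of_lt_one (by norm_num) (by norm_num))
  rw [norm_mul, norm_pow, norm_neg, norm_one, one_pow, one_mul]
  have h := norm_setIntegral_le_of_norm_le_const (μ := volume)
    (s := Ioo (0:ℝ) (2 ^ (-(m:ℤ)))) (C := 1) measure_Ioo_lt_top fun x hx =>
      norm_sign_mul_one_sub_logb_rpow_le hr (Ioo_zero_two_zpow_neg_subset m hx)
  rw [Real.volume_real_Ioo_of_le (by positivity)] at h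
  simpa using h

/-- Let `r ∈ (0,1)`. For every `k ≥ 0`,
`|∫_{(0, 2^{-(k+1)})} (-1)^{⌊-log₂ x⌋} (1 - log₂ x)^{-r} dx| ≤ 1/(2^{k+2} (k+2)^r)`,
and for every `l ≥ 0`,
`1/(2^{l+1} (l+2)^r) ≤ ∫_{(2^{-(l+1)}, 2^{-l})} (1 - log₂ x)^{-r} dx ≤ 1/(2^{l+1} (l+1)^r)`. -/
theorem statement15 (r : ℝ) (hr : r ∈ Set.Ioo (0:ℝ) 1) :
    (∀ k : ℕ,
      |∫ x in Set.Ioo (0:ℝ) ((2:ℝ) ^ (-((k:ℤ) + 1))),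
          (-1:ℝ) ^ ⌊-Real.logb 2 x⌋ * (1 - Real.logb 2 x) ^ (-r)| ≤
        1 / (2 ^ (k + 2) * ((k:ℝ) + 2) ^ r)) ∧
    (∀ l : ℕ,
      1 / (2 ^ (l + 1) * ((l:ℝ) + 2) ^ r) ≤
        (∫ x in Set.Ioo ((2:ℝ) ^ (-((l:ℤ) + 1))) ((2:ℝ) ^ (-(l:ℤ))),
          (1 - Real.logb 2 x) ^ (-r)) ∧
      (∫ x in Set.Ioo ((2:ℝ) ^ (-((l:ℤ) + 1))) ((2:ℝ) ^ (-(l:ℤ))),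
          (1 - Real.logb 2 x) ^ (-r)) ≤
        1 / (2 ^ (l + 1) * ((l:ℝ) + 1) ^ r)) := by
  have hr₀ : 0 ≤ r := hr.1.le
  refine ⟨fun k => ?_, integral_dyadic_one_sub_logb_rpow_bounds hr₀⟩
  have hnonneg := nonneg_of_add_succ_antitone (antitone_integral_dyadic_one_sub_logb_rpow hr₀)
    (fun m => by
      have hsq : ((-1:ℝ) ^ m) * (-1) ^ m = 1 := by rw [← mul_pow]; simp
      rw [integral_sign_mul_one_sub_logb_rpow_eq_add hr₀ m, pow_succ, Nat.cast_succ, mul_add,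
        ← mul_assoc ((-1:ℝ) ^ m) ((-1) ^ m), hsq]
      ring)
    (tendsto_integral_sign_mul_one_sub_logb_rpow hr₀)
  have h₁ := hnonneg (k + 1)
  have h₂ := hnonneg (k + 1 + 1)
  have hsplit := integral_sign_mul_one_sub_logb_rpow_eq_add hr₀ (k + 1)
  have hbound := (integral_dyadic_one_sub_logb_rpow_bounds hr₀ (k + 1)).2
  have hk : ((k + 1 : ℕ):ℝ) + 1 = k + 2 := by
    push_cast
    ring
  rw [hk] at hbound
  refine le_trans ?_ hbound
  rw [Nat.cast_succ (k + 1), pow_succ] at h₂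
  rw [← Nat.cast_succ k, Nat.succ_eq_add_one]
  rcases neg_one_pow_eq_or ℝ (k + 1) with hs | hs <;> rw [hs] at h₁ h₂ hsplit <;>
    rw [abs_le] <;> constructor <;> linarith
end
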